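/- Let f ∈ R_9 satisfy conditions (C1), (C2) and (C3). Then the absolute degree of f satisfies |f|_R ≥ 2; that is, for every nonzero locally nilpotent derivation D of R one has D²(f) ≠ 0. -/

import Mathlib

open MvPolynomial

set_option synthInstance.maxHeartbeats 400000
set_option maxHeartbeats 1000000

noncomputable section

/-- The grading weights `(3, 2, 1)` for the variables `x = X 0`, `y = X 1`, `z = X 2`
of `R = k[x,y,z]`. -/
def w3 : Fin 3 → ℕ := ![3, 2, 1]

/-- `D` is a locally nilpotent derivation: every element is killed by some power of `D`. -/
def IsLND {k B : Type*} [CommRing k] [CommRing B] [Algebra k B]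
    (D : Derivation k B B) : Prop :=
  ∀ b : B, ∃ n : ℕ, (⇑D)^[n] b = 0

/-- `S` is a regular local ring: a Noetherian local ring whose maximal ideal (equivalently,
its Jacobson radical) can be generated by Krull-dimension many elements. -/
def IsRegLocalRing (S : Type*) [CommRing S] : Prop :=
  IsNoetherianRing S ∧ IsLocalRing S ∧
    ∃ s : Finset S, Ideal.span (s : Set S) = (⊥ : Ideal S).jacobson ∧
      (s.card : WithBot (WithTop ℕ)) = ringKrullDim S

/-- The scheme `Proj ℬ` has at least two singular points, i.e. two distinct points whose
local rings (the stalks of the structure sheaf) are not regular local rings. -/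
def ProjHasTwoSingularPoints (k : Type) [Field k] {A : Type} [CommRing A] [Algebra k A]
    (ℬ : ℕ → Submodule k A) [GradedAlgebra ℬ] : Prop :=
  ∃ x y : AlgebraicGeometry.Proj ℬ, x ≠ y ∧
    ¬ IsRegLocalRing ((AlgebraicGeometry.Proj ℬ).presheaf.stalk x) ∧
    ¬ IsRegLocalRing ((AlgebraicGeometry.Proj ℬ).presheaf.stalk y)

/-- Condition (C2): the projective curve `Proj (R/fR)` has at least two singular points.
Here the grading on `R/fR` is the (unique) `ℕ`-grading `ℬ` induced by the weighted grading of
`R = k[x,y,z]` with weights `(3,2,1)` via the quotient map. -/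
def CondC2 (k : Type) [Field k] (f : MvPolynomial (Fin 3) k) : Prop :=
  ∃ (ℬ : ℕ → Submodule k (MvPolynomial (Fin 3) k ⧸ Ideal.span {f}))
    (inst : GradedAlgebra ℬ),
    (∀ (i : ℕ) (r : MvPolynomial (Fin 3) k), r.IsWeightedHomogeneous w3 i →
      Ideal.Quotient.mk (Ideal.span {f}) r ∈ ℬ i) ∧
    @ProjHasTwoSingularPoints k _ _ _ _ ℬ inst

/-- Condition (C3): `f(x,y,0) = x (p x² + q y³)` for some `p, q ∈ k*`. -/
def CondC3 (k : Type) [Field k] (f : MvPolynomial (Fin 3) k) : Prop :=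
  ∃ p q : k, p ≠ 0 ∧ q ≠ 0 ∧
    aeval ![X 0, X 1, 0] f = X 0 * (C p * X 0 ^ 2 + C q * X 1 ^ 3)

set_option linter.unusedSectionVars false


section LNDbasic
variable {k B : Type} [Field k] [CommRing B] [IsDomain B] [CharZero B] [Algebra k B]

theorem iter_zero_of_le (D : Derivation k B B) {u : B} {m n : ℕ} (h : (⇑D)^[m] u = 0)
    (hmn : m ≤ n) : (⇑D)^[n] u = 0 := by
  obtain ⟨r, rfl⟩ := Nat.exists_eq_add_of_le hmn
  rw [add_comm, Function.iterate_add_apply, h]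
  exact iterate_map_zero D r

theorem iter_add (D : Derivation k B B) (n : ℕ) (u v : B) :
    (⇑D)^[n] (u + v) = (⇑D)^[n] u + (⇑D)^[n] v := iterate_map_add D n u v

theorem iter_sub (D : Derivation k B B) (n : ℕ) (u v : B) :
    (⇑D)^[n] (u - v) = (⇑D)^[n] u - (⇑D)^[n] v := iterate_map_sub D n u v

theorem iter_ker_mul (D : Derivation k B B) (n : ℕ) {c : B} (hc : D c = 0) (u : B) :
    (⇑D)^[n] (c * u) = c * (⇑D)^[n] u := by
  induction n generalizing u with
  | zero => rfl
  | succ n ih =>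
    rw [Function.iterate_succ_apply, Function.iterate_succ_apply, ← ih]
    congr 1
    simp [hc]

theorem iter_mul_aux (D : Derivation k B B) (N : ℕ) : ∀ (m n : ℕ) (u v : B), m + n = N →
    (⇑D)^[m+1] u = 0 → (⇑D)^[n+1] v = 0 →
    (⇑D)^[m+n] (u * v) = ((m+n).choose m : B) * ((⇑D)^[m] u * (⇑D)^[n] v) := by
  induction N with
  | zero =>
    intro m n u v h hu hv
    obtain ⟨rfl, rfl⟩ : m = 0 ∧ n = 0 := by omega
    simp
  | succ N ih =>
    intro m n u v h hu hv
    rcases m with _ | m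
    · have hu' : D u = 0 := by simpa using hu
      simp [iter_ker_mul D n hu']
    rcases n with _ | n
    · have hv' : D v = 0 := by simpa using hv
      rw [mul_comm u v, iter_ker_mul D _ hv']
      simp [mul_comm]
    have e1 : m + 1 + (n + 1) = (m + n + 1) + 1 := by ring
    rw [e1, Function.iterate_succ_apply, D.leibniz, smul_eq_mul, smul_eq_mul, iter_add]
    have h1 := ih (m+1) n u (D v) (by omega) hu (by simpa using hv)
    have h2 := ih m (n+1) (D u) v (by omega) (by simpa using hu) hv
    have e2 : m + 1 + n = m + n + 1 := by ring
    have e3 : m + (n + 1) = m + n + 1 := by ring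
    rw [e2] at h1
    rw [e3] at h2
    rw [mul_comm v (D u), h1, h2, Nat.choose_succ_succ (m+n+1) m]
    simp only [← Function.iterate_succ_apply]
    push_cast
    ring

/-- `u` has `D`-degree exactly `n`. -/
def HasDeg (D : Derivation k B B) (u : B) (n : ℕ) : Prop :=
  (⇑D)^[n] u ≠ 0 ∧ (⇑D)^[n+1] u = 0

theorem HasDeg.ne_zero {D : Derivation k B B} {u : B} {n : ℕ} (h : HasDeg D u n) : u ≠ 0 := by
  rintro rfl
  exact h.1 (iterate_map_zero D n)

theorem HasDeg.exists {D : Derivation k B B} (hD : IsLND D) {u : B} (hu : u ≠ 0) :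
    ∃ n, HasDeg D u n := by
  classical
  have hex := hD u
  have h0 : Nat.find hex ≠ 0 := by
    intro h
    have := Nat.find_spec hex
    rw [h] at this
    exact hu this
  obtain ⟨n, hn⟩ := Nat.exists_eq_succ_of_ne_zero h0
  refine ⟨n, Nat.find_min hex (by omega), ?_⟩
  have := Nat.find_spec hex
  rwa [hn] at this

theorem HasDeg.lt_of_zero {D : Derivation k B B} {u : B} {n m : ℕ} (h : HasDeg D u n)
    (hm : (⇑D)^[m] u = 0) : n < m := by
  by_contra hlt
  exact h.1 (iter_zero_of_le D hm (by omega))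

theorem HasDeg.unique {D : Derivation k B B} {u : B} {n m : ℕ} (h : HasDeg D u n)
    (h' : HasDeg D u m) : n = m := by
  have := h.lt_of_zero h'.2
  have := h'.lt_of_zero h.2
  omega

theorem HasDeg.mul {D : Derivation k B B} {u v : B} {m n : ℕ} (hu : HasDeg D u m)
    (hv : HasDeg D v n) : HasDeg D (u * v) (m + n) := by
  have h := iter_mul_aux D (m+n) m n u v rfl hu.2 hv.2
  refine ⟨?_, ?_⟩
  · rw [h]
    refine mul_ne_zero ?_ (mul_ne_zero hu.1 hv.1)
    exact_mod_cast (Nat.choose_pos (by omega)).ne'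
  · rw [Function.iterate_succ_apply', h]
    have a1 : D ((⇑D)^[m] u) = 0 := by rw [← Function.iterate_succ_apply' (⇑D)]; exact hu.2
    have a2 : D ((⇑D)^[n] v) = 0 := by rw [← Function.iterate_succ_apply' (⇑D)]; exact hv.2
    simp [a1, a2]

theorem HasDeg.of_ker {D : Derivation k B B} {u : B} (hu : u ≠ 0) (h : D u = 0) :
    HasDeg D u 0 := ⟨hu, h⟩

theorem HasDeg.pow {D : Derivation k B B} {u : B} {m : ℕ} (hu : HasDeg D u m) (q : ℕ) :
    HasDeg D (u ^ q) (m * q) := by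
  induction q with
  | zero => simpa using HasDeg.of_ker (D := D) one_ne_zero (by simp)
  | succ q ih => rw [pow_succ, Nat.mul_succ]; exact ih.mul hu

theorem ker_of_mul {D : Derivation k B B} (hD : IsLND D) {u v : B} (h0 : u * v ≠ 0)
    (h : D (u * v) = 0) : D u = 0 := by
  obtain ⟨m, hm⟩ := HasDeg.exists hD (left_ne_zero_of_mul h0)
  obtain ⟨n, hn⟩ := HasDeg.exists hD (right_ne_zero_of_mul h0)
  have := (hm.mul hn).unique (HasDeg.of_ker h0 h)
  obtain rfl : m = 0 := by omega
  exact hm.2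

/-- If `p ∣ D p` then `D p = 0`. -/
theorem ker_of_dvd {D : Derivation k B B} (hD : IsLND D) {p : B} (hp : p ≠ 0)
    (h : ∀ r, p ∣ D r) : D p = 0 := by
  obtain ⟨m, hm⟩ := HasDeg.exists hD hp
  rcases m with _ | m
  · exact hm.2
  have h1 : p ∣ (⇑D)^[m+1] p := by
    rw [Function.iterate_succ_apply']
    exact h _
  obtain ⟨c, hc⟩ := h1
  refine ker_of_mul hD (v := c) (hc ▸ hm.1) ?_
  rw [← hc, ← Function.iterate_succ_apply' (⇑D)]
  exact hm.2

end LNDbasic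


/-- A graded domain of dimension at most two with a homogeneous locally nilpotent derivation. -/
structure LS (k B : Type) [Field k] [CommRing B] [Algebra k B] where
  Gr : ℤ → Submodule k B
  one_mem : 1 ∈ Gr 0
  mul_mem : ∀ {d e : ℤ} {u v : B}, u ∈ Gr d → v ∈ Gr e → u * v ∈ Gr (d + e)
  zero_deg : ∀ {u : B}, u ∈ Gr 0 → ∃ c : k, u = algebraMap k B c
  neg_deg : ∀ {d : ℤ} {u : B}, d < 0 → u ∈ Gr d → u = 0
  indep : ∀ (s : Finset ℤ) (g : ℤ → B), (∀ i, g i ∈ Gr i) → ∑ i ∈ s, g i = 0 →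
    ∀ i ∈ s, g i = 0
  D : Derivation k B B
  δ : ℤ
  D_mem : ∀ {d : ℤ} {u : B}, u ∈ Gr d → D u ∈ Gr (d + δ)
  lnd : IsLND D
  slice : ∃ (d : ℤ) (s : B), s ∈ Gr d ∧ D s ≠ 0
  no3 : ∀ x : Option (Fin 2) → B, ¬ AlgebraicIndependent k x

section LSsec
variable {k B : Type} [Field k] [IsAlgClosed k] [CharZero k] [CommRing B] [IsDomain B]
  [CharZero B] [Algebra k B]

theorem LS.pow_mem (S : LS k B) {d : ℤ} {u : B} (hu : u ∈ S.Gr d) (n : ℕ) :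
    u ^ n ∈ S.Gr (n * d) := by
  induction n with
  | zero => simpa using S.one_mem
  | succ n ih =>
    rw [pow_succ]
    have := S.mul_mem ih hu
    convert this using 2
    push_cast; ring

theorem LS.iter_mem (S : LS k B) {d : ℤ} {u : B} (hu : u ∈ S.Gr d) (n : ℕ) :
    (⇑S.D)^[n] u ∈ S.Gr (d + n * S.δ) := by
  induction n with
  | zero => simpa using hu
  | succ n ih =>
    rw [Function.iterate_succ_apply']
    have := S.D_mem ih
    convert this using 2
    push_cast; ring

theorem LS.cast (S : LS k B) {d e : ℤ} {u : B} (hu : u ∈ S.Gr d) (h : d = e) : u ∈ S.Gr e :=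
  h ▸ hu

/-- kernel subalgebra -/
def kerAlg (D : Derivation k B B) : Subalgebra k B where
  carrier := {b | D b = 0}
  mul_mem' := by
    intro a b ha hb
    simp only [Set.mem_ofPred_eq] at *
    simp [ha, hb]
  add_mem' := by
    intro a b ha hb
    simp only [Set.mem_ofPred_eq] at *
    simp [ha, hb]
  algebraMap_mem' := by
    intro r
    simp

theorem mem_kerAlg {D : Derivation k B B} {b : B} : b ∈ kerAlg D ↔ D b = 0 := Iff.rfl

/-- `D` as a derivation over its kernel. -/
def kerDer (D : Derivation k B B) : Derivation (kerAlg D) B B :=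
  Derivation.mk'
    { toFun := D
      map_add' := fun a b => map_add D a b
      map_smul' := by
        intro c b
        have hc : D (c : B) = 0 := c.2
        change D ((c : B) * b) = (c : B) * D b
        simp [hc] }
    (fun a b => D.leibniz a b)

theorem slice_transc (D : Derivation k B B) {s : B} (hs : D s ≠ 0) :
    Transcendental (kerAlg D) s := by
  rw [transcendental_iff]
  intro p
  induction hn : p.natDegree using Nat.strong_induction_on generalizing p with
  | _ n ih =>
    intro hp
    have h1 : (kerDer D) (Polynomial.aeval s p) = 0 := by rw [hp, map_zero]
    rw [Derivation.map_aeval] at h1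
    have h2 : Polynomial.aeval s (Polynomial.derivative p) = 0 := by
      rcases smul_eq_zero.1 h1 with h | h
      · exact h
      · exact absurd h hs
    have hdeg : p.natDegree = 0 := by
      by_contra h0
      have h3 := ih _ (hn ▸ Polynomial.natDegree_derivative_lt h0) _ rfl h2
      exact h0 (Polynomial.derivative_eq_zero.1 h3)
    rw [Polynomial.eq_C_of_natDegree_eq_zero hdeg] at hp ⊢
    rw [Polynomial.aeval_C] at hp
    have : p.coeff 0 = 0 := by
      apply Subtype.ext
      exact hp
    rw [this, map_zero]

theorem root_const {L : Type} [Field L] [Algebra k L] {q : Polynomial k} (hq0 : q ≠ 0) {ρ : L}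
    (hqρ : Polynomial.aeval ρ q = 0) : ∃ c : k, algebraMap k L c = ρ := by
  have hsp := IsAlgClosed.splits q
  rw [hsp.eq_prod_roots] at hqρ
  simp only [map_mul, Polynomial.aeval_C, map_multiset_prod, Multiset.map_map, mul_eq_zero,
    Multiset.prod_eq_zero_iff, Multiset.mem_map, Function.comp] at hqρ
  rcases hqρ with h | ⟨c, -, h⟩
  · rw [FaithfulSMul.algebraMap_eq_zero_iff] at h
    exact absurd (Polynomial.leadingCoeff_eq_zero.1 h) hq0
  · refine ⟨c, ?_⟩
    simp only [map_sub, Polynomial.aeval_X, Polynomial.aeval_C] at h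
    exact (sub_eq_zero.1 h).symm

/-- homogeneous kernel elements of the same degree are proportional -/
theorem LS.prop_aux (L : Type) [Field L] [Algebra B L] [Algebra k L] [IsScalarTower k B L]
    [FaithfulSMul B L] (S : LS k B) {d : ℤ} {U V : B} (hU : U ∈ S.Gr d) (hV : V ∈ S.Gr d)
    (hDU : S.D U = 0) (hDV : S.D V = 0) (hV0 : V ≠ 0) : ∃ c : k, U = algebraMap k B c * V := by
  classical
  rcases lt_trichotomy d 0 with hd | hd | hd
  · exact absurd (S.neg_deg hd hV) hV0
  · subst hd
    obtain ⟨a, rfl⟩ := S.zero_deg hU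
    obtain ⟨b, rfl⟩ := S.zero_deg hV
    have hb : b ≠ 0 := by rintro rfl; simp at hV0
    exact ⟨a / b, by rw [← map_mul, div_mul_cancel₀ _ hb]⟩
  -- algebraic dependence
  have hdep : ¬ AlgebraicIndependent k ![U, V] := by
    intro hind
    obtain ⟨e, s, hs, hDs⟩ := S.slice
    have ht : Transcendental (Algebra.adjoin k (Set.range ![U, V])) s := by
      have hle : Algebra.adjoin k (Set.range ![U, V]) ≤ kerAlg S.D := by
        rw [Algebra.adjoin_le_iff]
        rintro _ ⟨i, rfl⟩
        fin_cases i
        · exact hDU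
        · exact hDV
      have h0 := slice_transc S.D hDs
      rw [transcendental_iff] at h0 ⊢
      intro p hp
      let ι := Subalgebra.inclusion hle
      have h1 : p.map ι.toRingHom = 0 := by
        apply h0
        rw [Polynomial.aeval_def, Polynomial.eval₂_map]
        exact hp
      rw [Polynomial.map_eq_zero_iff (Subalgebra.inclusion_injective hle)] at h1
      exact h1
    exact S.no3 _ ((hind.option_iff_transcendental s).2 ht)
  rw [algebraicIndependent_iff] at hdep
  push Not at hdep
  obtain ⟨Φ, hΦ, hΦ0⟩ := hdep
  obtain ⟨m0, hm0⟩ := MvPolynomial.ne_zero_iff.1 hΦ0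
  -- homogeneous piece
  have hexp : ∑ m ∈ Φ.support, algebraMap k B (Φ.coeff m) * (U ^ m 0 * V ^ m 1) = 0 := by
    rw [← hΦ, MvPolynomial.aeval_def, MvPolynomial.eval₂_eq']
    simp [Fin.prod_univ_two]
  let dg : (Fin 2 →₀ ℕ) → ℤ := fun m => ((m 0 + m 1 : ℕ) : ℤ) * d
  let g : ℤ → B := fun n => ∑ m ∈ Φ.support with dg m = n,
    algebraMap k B (Φ.coeff m) * (U ^ m 0 * V ^ m 1)
  have hg : ∀ n, g n ∈ S.Gr n := by
    intro n
    refine Submodule.sum_mem _ fun m hm => ?_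
    rw [Finset.mem_filter] at hm
    rw [← Algebra.smul_def]
    refine Submodule.smul_mem _ _ ?_
    refine S.cast (S.mul_mem (S.pow_mem hU _) (S.pow_mem hV _)) ?_
    rw [← hm.2]
    simp only [dg]; push_cast; ring
  have hsum : ∑ n ∈ Φ.support.image dg, g n = 0 := by
    rw [← hexp]
    exact Finset.sum_fiberwise_of_maps_to (fun m hm => Finset.mem_image_of_mem _ hm) _
  have hm0s : m0 ∈ Φ.support := MvPolynomial.mem_support_iff.2 hm0
  have hz := S.indep _ g hg hsum (dg m0) (Finset.mem_image_of_mem _ hm0s)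
  -- pass to the fraction field
  set ρ : L := algebraMap B L U / algebraMap B L V with hρ
  have hVL : algebraMap B L V ≠ 0 := by simpa using hV0
  let q : Polynomial k := ∑ m ∈ Φ.support with dg m = dg m0,
    Polynomial.monomial (m 0) (Φ.coeff m)
  have hdgeq : ∀ m, dg m = dg m0 → m 0 + m 1 = m0 0 + m0 1 := by
    intro m hm
    have := mul_right_cancel₀ hd.ne' hm
    exact_mod_cast this
  have hq0 : q ≠ 0 := by
    intro h
    have : q.coeff (m0 0) = Φ.coeff m0 := by
      simp only [q, Polynomial.finsetSum_coeff, Polynomial.coeff_monomial]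
      rw [Finset.sum_eq_single m0]
      · simp
      · intro m hm hne
        rw [if_neg]
        intro h0
        apply hne
        rw [Finset.mem_filter] at hm
        have := hdgeq m hm.2
        ext i
        fin_cases i
        · exact h0
        · simp only [Fin.mk_one, Fin.isValue]; omega
      · intro h
        exact absurd (Finset.mem_filter.2 ⟨hm0s, (rfl : dg m0 = dg m0)⟩) h
    rw [h] at this
    exact hm0 (by simpa using this.symm)
  have hqρ : Polynomial.aeval ρ q = 0 := by
    have h1 : algebraMap B L V ^ (m0 0 + m0 1) * Polynomial.aeval ρ q
        = algebraMap B L (g (dg m0)) := by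
      simp only [q, g, map_sum, Finset.mul_sum]
      refine Finset.sum_congr rfl fun m hm => ?_
      rw [Finset.mem_filter] at hm
      rw [← hdgeq m hm.2, Polynomial.aeval_monomial, hρ, map_mul, map_mul, map_pow, map_pow,
        ← IsScalarTower.algebraMap_apply k B L, pow_add, div_pow]
      field_simp
    rw [hz, (algebraMap B L).map_zero] at h1
    exact (mul_eq_zero.1 h1).resolve_left (pow_ne_zero _ hVL)
  have halg : ∃ c : k, algebraMap k L c = ρ := root_const hq0 hqρ
  obtain ⟨c, hc⟩ := halg
  refine ⟨c, ?_⟩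
  apply FaithfulSMul.algebraMap_injective B L
  rw [map_mul, ← IsScalarTower.algebraMap_apply k B L, hc, hρ]
  field_simp

theorem LS.prop (S : LS k B) {d : ℤ} {U V : B} (hU : U ∈ S.Gr d) (hV : V ∈ S.Gr d)
    (hDU : S.D U = 0) (hDV : S.D V = 0) (hV0 : V ≠ 0) : ∃ c : k, U = algebraMap k B c * V :=
  LS.prop_aux (FractionRing B) S hU hV hDU hDV hV0

/-- powers of homogeneous kernel elements are proportional -/
theorem LS.kpow (S : LS k B) {d e : ℕ} {U V : B} (hU : U ∈ S.Gr d) (hV : V ∈ S.Gr e)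
    (hDU : S.D U = 0) (hDV : S.D V = 0) (hU0 : U ≠ 0) (hV0 : V ≠ 0) :
    ∃ c : k, c ≠ 0 ∧ U ^ e = algebraMap k B c * V ^ d := by
  obtain ⟨c, hc⟩ := S.prop (S.pow_mem hU e)
    (S.cast (S.pow_mem hV d) (mul_comm _ _)) (by simp [Derivation.leibniz_pow, hDU])
    (by simp [Derivation.leibniz_pow, hDV]) (pow_ne_zero _ hV0)
  refine ⟨c, ?_, hc⟩
  rintro rfl
  simp only [map_zero, zero_mul] at hc
  exact pow_ne_zero _ hU0 hc

theorem LS.kinv (S : LS k B) {d : ℤ} {H : ℕ} (hH : 0 < H) {κ h : B} (hκ : κ ∈ S.Gr d)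
    (hh : h ∈ S.Gr H) (hDκ : S.D κ = 0) (hDh : S.D h = 0) (hκ0 : κ ≠ 0) (hh0 : h ≠ 0) :
    ∃ (κ' : B) (i : ℕ), κ' ∈ S.Gr (i * H - d) ∧ S.D κ' = 0 ∧ κ' ≠ 0 ∧ κ * κ' = h ^ i := by
  have hd : 0 ≤ d := by
    by_contra h'
    exact hκ0 (S.neg_deg (by omega) hκ)
  lift d to ℕ using hd
  obtain ⟨c, hc0, hc⟩ := S.kpow hκ hh hDκ hDh hκ0 hh0
  obtain ⟨H, rfl⟩ := Nat.exists_eq_succ_of_ne_zero hH.ne'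
  refine ⟨algebraMap k B c⁻¹ * κ ^ H, d, ?_, ?_, ?_, ?_⟩
  · rw [← Algebra.smul_def]
    refine Submodule.smul_mem _ _ (S.cast (S.pow_mem hκ _) ?_)
    push_cast; ring
  · simp [Derivation.leibniz_pow, hDκ]
  · refine mul_ne_zero ?_ (pow_ne_zero _ hκ0)
    simpa using hc0
  · rw [pow_succ] at hc
    calc _ = algebraMap k B c⁻¹ * (κ ^ H * κ) := by ring
      _ = _ := by rw [hc, ← mul_assoc, ← map_mul, inv_mul_cancel₀ hc0, map_one, one_mul]

end LSsec


section LSsec2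
variable {k B : Type} [Field k] [IsAlgClosed k] [CharZero k] [CommRing B] [IsDomain B]
  [CharZero B] [Algebra k B]

theorem LS.local_slice (S : LS k B) : ∃ (d : ℤ) (s : B), s ∈ S.Gr d ∧ S.D s ≠ 0 ∧
    S.D (S.D s) = 0 := by
  obtain ⟨d, s, hs, hDs⟩ := S.slice
  have hs0 : s ≠ 0 := by rintro rfl; simp at hDs
  obtain ⟨n, hn⟩ := HasDeg.exists S.lnd hs0
  rcases n with _ | n
  · exact absurd hn.2 hDs
  refine ⟨_, _, S.iter_mem hs n, ?_, ?_⟩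
  · rw [← Function.iterate_succ_apply' (⇑S.D)]; exact hn.1
  · rw [← Function.iterate_succ_apply' (⇑S.D), ← Function.iterate_succ_apply' (⇑S.D)]; exact hn.2

theorem LS.theta (L : Type) [Field L] [Algebra B L] [Algebra k L] [IsScalarTower k B L]
    [FaithfulSMul B L] (S : LS k B) {H : ℕ} (hH : 0 < H) {h : B} (hh : h ∈ S.Gr H)
    (hDh : S.D h = 0) (hh0 : h ≠ 0) :
    ∃ (b0 : B) (j0 : ℕ), b0 ∈ S.Gr (j0 * H) ∧ ∀ (j : ℕ) (b : B), b ∈ S.Gr (j * H) →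
      ∃ q : Polynomial k, algebraMap B L b =
        algebraMap B L h ^ j * Polynomial.aeval (algebraMap B L b0 / algebraMap B L h ^ j0) q := by
  classical
  have hhL : algebraMap B L h ≠ 0 := by simpa using hh0
  -- kernel case
  have hker : ∀ (x : L) (j : ℕ) (b : B), b ∈ S.Gr (j * H) → S.D b = 0 →
      ∃ q : Polynomial k, algebraMap B L b = algebraMap B L h ^ j * Polynomial.aeval x q := by
    intro x j b hb hDb
    obtain ⟨c, hc⟩ := S.prop hb (S.pow_mem hh j) hDb (by simp [Derivation.leibniz_pow, hDh])
      (pow_ne_zero _ hh0)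
    refine ⟨Polynomial.C c, ?_⟩
    rw [hc, map_mul, map_pow, Polynomial.aeval_C, ← IsScalarTower.algebraMap_apply k B L, mul_comm]
  by_cases hex : ∃ m, 0 < m ∧ ∃ (j : ℕ) (b : B), b ∈ S.Gr (j * H) ∧ HasDeg S.D b m
  swap
  · refine ⟨1, 0, by simpa using S.one_mem, fun j b hb => ?_⟩
    rcases eq_or_ne b 0 with rfl | hb0
    · exact ⟨0, by simp⟩
    obtain ⟨n, hn⟩ := HasDeg.exists S.lnd hb0
    rcases Nat.eq_zero_or_pos n with rfl | hpos
    · exact hker _ j b hb hn.2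
    · exact absurd ⟨n, hpos, j, b, hb, hn⟩ hex
  obtain ⟨hm, j0, b0, hb0, hd0⟩ := Nat.find_spec hex
  have hmin : ∀ r, r < Nat.find hex → 0 < r → ∀ (j : ℕ) (b : B), b ∈ S.Gr (j * H) →
      ¬ HasDeg S.D b r := by
    intro r hr hr0 j b hb hd
    exact Nat.find_min hex hr ⟨hr0, j, b, hb, hd⟩
  generalize Nat.find hex = m at *
  refine ⟨b0, j0, hb0, ?_⟩
  set θ : L := algebraMap B L b0 / algebraMap B L h ^ j0 with hθ
  have key : ∀ (N : ℕ) (j : ℕ) (b : B), b ∈ S.Gr (j * H) → (⇑S.D)^[N] b = 0 →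
      ∃ q : Polynomial k, algebraMap B L b = algebraMap B L h ^ j * Polynomial.aeval θ q := by
    intro N
    induction N with
    | zero =>
      intro j b hb h0
      refine ⟨0, ?_⟩
      have : b = 0 := h0
      simp [this]
    | succ n ih =>
      intro j b hb hzero
      by_cases hlow : (⇑S.D)^[n] b = 0
      · exact ih j b hb hlow
      have hd : HasDeg S.D b n := ⟨hlow, hzero⟩
      have hmn := Nat.div_add_mod n m
      set q := n / m
      set r := n % m
      -- show r = 0
      have hr : r = 0 := by
        by_contra hr0
        obtain ⟨ds, s, hs, hDs, hDDs⟩ := S.local_slice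
        have hσ := S.D_mem hs
        obtain ⟨σ', i', hσ'm, hσ'D, hσ'0, -⟩ := S.kinv hH hσ hh hDDs hDh hDs hh0
        have hκm := S.iter_mem hb0 m
        have hκD : S.D ((⇑S.D)^[m] b0) = 0 := by
          rw [← Function.iterate_succ_apply' (⇑S.D)]; exact hd0.2
        obtain ⟨κ', i, hκ'm, hκ'D, hκ'0, -⟩ := S.kinv hH hκm hh hκD hDh hd0.1 hh0
        have hbm := S.iter_mem hb n
        have hbD : S.D ((⇑S.D)^[n] b) = 0 := by
          rw [← Function.iterate_succ_apply' (⇑S.D)]; exact hzero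
        have hsdeg : HasDeg S.D s 1 := ⟨hDs, hDDs⟩
        have hη : HasDeg S.D (s ^ r * ((⇑S.D)^[n] b * (κ' ^ q * σ' ^ r))) r := by
          have := (hsdeg.pow r).mul ((HasDeg.of_ker hlow hbD).mul
            (((HasDeg.of_ker hκ'0 hκ'D).pow q).mul ((HasDeg.of_ker hσ'0 hσ'D).pow r)))
          simpa using this
        have hηm := S.mul_mem (S.pow_mem hs r) (S.mul_mem hbm
          (S.mul_mem (S.pow_mem hκ'm q) (S.pow_mem hσ'm r)))
        have hdegeq : (r : ℤ) * ds + (j * H + n * S.δ + (q * (i * H - (j0 * H + m * S.δ)) +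
            r * (i' * H - (ds + S.δ)))) = (j + q * i - q * j0 + r * i') * H := by
          have : (n : ℤ) = m * q + r := by exact_mod_cast hmn.symm
          rw [this]; ring
        rw [hdegeq] at hηm
        have hnn : 0 ≤ (j + q * i - q * j0 + r * i' : ℤ) := by
          by_contra hneg
          refine hη.ne_zero (S.neg_deg ?_ hηm)
          exact mul_neg_of_neg_of_pos (by omega) (by exact_mod_cast hH)
        obtain ⟨J, hJ⟩ := Int.eq_ofNat_of_zero_le hnn
        rw [hJ] at hηm
        exact hmin r (Nat.mod_lt _ hm) (Nat.pos_of_ne_zero hr0) J _ hηm hη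
      have hnm : n = m * q := by omega
      -- subtract
      have hA := (HasDeg.of_ker (pow_ne_zero (j0 * q) hh0)
        (by simp [Derivation.leibniz_pow, hDh] : S.D (h ^ (j0 * q)) = 0)).mul hd
      rw [zero_add] at hA
      have hBd := (HasDeg.of_ker (pow_ne_zero j hh0)
        (by simp [Derivation.leibniz_pow, hDh] : S.D (h ^ j) = 0)).mul (hd0.pow q)
      rw [zero_add, ← hnm] at hBd
      have hAm := S.mul_mem (S.pow_mem hh (j0 * q)) hb
      have hBm := S.mul_mem (S.pow_mem hh j) (S.pow_mem hb0 q)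
      have hAm' := S.cast hAm (by push_cast; ring : _ = (((j + j0 * q : ℕ) : ℤ) * H))
      have hBm' := S.cast hBm (by push_cast; ring : _ = (((j + j0 * q : ℕ) : ℤ) * H))
      have hDA := hA.2
      have hDB := hBd.2
      rw [Function.iterate_succ_apply'] at hDA hDB
      obtain ⟨c, hc⟩ := S.prop (S.iter_mem hAm' n) (S.iter_mem hBm' n) hDA hDB hBd.1
      obtain ⟨Q, hQ⟩ := ih (j + j0 * q)
        (h ^ (j0 * q) * b - algebraMap k B c * (h ^ j * b0 ^ q))
        (by
          refine Submodule.sub_mem _ hAm' ?_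
          rw [← Algebra.smul_def]
          exact Submodule.smul_mem _ _ hBm')
        (by rw [iter_sub, iter_ker_mul S.D n (by simp : S.D (algebraMap k B c) = 0), hc, sub_self])
      refine ⟨Q + Polynomial.C c * Polynomial.X ^ q, ?_⟩
      have hp : algebraMap B L h ^ (j0 * q) ≠ 0 := pow_ne_zero _ hhL
      apply mul_left_cancel₀ hp
      simp only [map_sub, map_mul, map_pow, ← IsScalarTower.algebraMap_apply k B L] at hQ
      simp only [map_add, map_mul, map_pow, Polynomial.aeval_C, Polynomial.aeval_X]
      rw [sub_eq_iff_eq_add] at hQ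
      rw [hQ, pow_add, hθ, div_pow, ← pow_mul]
      field_simp
  intro j b hb
  rcases S.lnd b with ⟨N, hN⟩
  exact key N j b hb hN

/-- numerators of polynomial values -/
theorem LS.num (L : Type) [Field L] [Algebra B L] [Algebra k L] [IsScalarTower k B L]
    [FaithfulSMul B L] (S : LS k B) {H : ℕ} {h : B} (hh : h ∈ S.Gr H)
    (hh0 : h ≠ 0) {b0 : B} {j0 : ℕ} (hb0 : b0 ∈ S.Gr (j0 * H)) (q : Polynomial k) (N : ℕ)
    (hN : q.natDegree ≤ N) :
    ∃ c ∈ S.Gr ((j0 * N : ℕ) * H), algebraMap B L c = algebraMap B L h ^ (j0 * N) *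
      Polynomial.aeval (algebraMap B L b0 / algebraMap B L h ^ j0) q := by
  have hhL : algebraMap B L h ≠ 0 := by simpa using hh0
  refine ⟨∑ i ∈ Finset.range (N + 1), algebraMap k B (q.coeff i) *
    (b0 ^ i * h ^ (j0 * (N - i))), ?_, ?_⟩
  · refine Submodule.sum_mem _ fun i hi => ?_
    rw [← Algebra.smul_def]
    refine Submodule.smul_mem _ _ (S.cast (S.mul_mem (S.pow_mem hb0 i) (S.pow_mem hh _)) ?_)
    have hi' : i ≤ N := by simpa [Nat.lt_succ_iff] using hi
    push_cast [Nat.cast_sub hi']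
    ring
  · rw [Polynomial.aeval_eq_sum_range' (Nat.lt_succ_of_le hN), map_sum, Finset.mul_sum]
    refine Finset.sum_congr rfl fun i hi => ?_
    have hi' : i ≤ N := by simpa [Nat.lt_succ_iff] using hi
    have e : j0 * N = j0 * i + j0 * (N - i) := by rw [← mul_add]; congr 1; omega
    rw [map_mul, map_mul, map_pow, map_pow, ← IsScalarTower.algebraMap_apply k B L,
      Algebra.smul_def, div_pow, ← pow_mul, e, pow_add]
    field_simp

/-- the valuation property at primes not containing a homogeneous kernel element -/
theorem LS.vr1_aux (L : Type) [Field L] [Algebra B L] [Algebra k L] [IsScalarTower k B L]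
    [FaithfulSMul B L] (S : LS k B) {H : ℕ} (hH : 0 < H) {h : B} (hh : h ∈ S.Gr H)
    (hDh : S.D h = 0) (P : Ideal B) [P.IsPrime] (hP : h ∉ P) {d : ℕ} {b b' : B}
    (hb : b ∈ S.Gr d) (hb' : b' ∈ S.Gr d) :
    ∃ (e : ℕ) (v c : B), v ∈ S.Gr e ∧ c ∈ S.Gr e ∧ v ∉ P ∧ (b * v = b' * c ∨ b' * v = b * c) := by
  classical
  have hone : (1 : B) ∉ P := fun h1 => hP (by simpa using P.mul_mem_left h h1)
  rcases eq_or_ne b' 0 with rfl | hb'0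
  · exact ⟨0, 1, 0, by simpa using S.one_mem, Submodule.zero_mem _, hone, Or.inr (by simp)⟩
  have hh0 : h ≠ 0 := by rintro rfl; exact hP P.zero_mem
  have hhL : algebraMap B L h ≠ 0 := by simpa using hh0
  obtain ⟨b0, j0, hb0, hT⟩ := S.theta L hH hh hDh hh0
  set θ : L := algebraMap B L b0 / algebraMap B L h ^ j0 with hθ
  obtain ⟨H, rfl⟩ := Nat.exists_eq_succ_of_ne_zero hH.ne'
  obtain ⟨β, hβ⟩ := hT d (b * b' ^ H) (S.cast (S.mul_mem hb (S.pow_mem hb' H))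
    (by push_cast; ring))
  obtain ⟨β', hβ'⟩ := hT d (b' * b' ^ H) (S.cast (S.mul_mem hb' (S.pow_mem hb' H))
    (by push_cast; ring))
  have hβ'0 : β' ≠ 0 := by
    rintro rfl
    rw [map_zero, mul_zero, ← pow_succ', map_pow] at hβ'
    have : algebraMap B L b' = 0 := pow_eq_zero_iff (by omega) |>.1 hβ'
    exact hb'0 (by simpa using this)
  obtain ⟨γ, hγ⟩ : ∃ γ, γ = EuclideanDomain.gcd β β' := ⟨_, rfl⟩
  have hγ0 : γ ≠ 0 := by
    intro h0
    rw [hγ, EuclideanDomain.gcd_eq_zero_iff] at h0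
    exact hβ'0 h0.2
  obtain ⟨β1, hβ1⟩ := EuclideanDomain.gcd_dvd_left β β'
  obtain ⟨β1', hβ1'⟩ := EuclideanDomain.gcd_dvd_right β β'
  rw [← hγ] at hβ1 hβ1'
  have hbez := EuclideanDomain.gcd_eq_gcd_ab β β'
  rw [← hγ] at hbez
  set x := EuclideanDomain.gcdA β β'
  set y := EuclideanDomain.gcdB β β'
  have hbez1 : β1 * x + β1' * y = 1 := by
    apply mul_left_cancel₀ hγ0
    rw [mul_one, mul_add, ← mul_assoc, ← mul_assoc, ← hβ1, ← hβ1']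
    exact hbez.symm
  let N := β1.natDegree + β1'.natDegree + x.natDegree + y.natDegree
  obtain ⟨c1, hc1, hc1e⟩ := S.num L hh hh0 hb0 β1 N (by omega)
  obtain ⟨c2, hc2, hc2e⟩ := S.num L hh hh0 hb0 β1' N (by omega)
  obtain ⟨x1, hx1, hx1e⟩ := S.num L hh hh0 hb0 x N (by omega)
  obtain ⟨y1, hy1, hy1e⟩ := S.num L hh hh0 hb0 y N (by omega)
  rw [← hθ] at hc1e hc2e hx1e hy1e
  have hinj : Function.Injective (algebraMap B L) := FaithfulSMul.algebraMap_injective B L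
  have hsum : c1 * x1 + c2 * y1 = h ^ (j0 * N) * h ^ (j0 * N) := by
    apply hinj
    have := congrArg (Polynomial.aeval θ) hbez1
    simp only [map_add, map_mul, map_one, map_pow] at this ⊢
    rw [hc1e, hc2e, hx1e, hy1e]
    linear_combination (algebraMap B L h ^ (j0 * N) * algebraMap B L h ^ (j0 * N)) * this
  have hrel : b * c2 = b' * c1 := by
    apply hinj
    have hb'L : algebraMap B L b' ^ H ≠ 0 := pow_ne_zero _ (by simpa using hb'0)
    apply mul_left_cancel₀ hb'L
    simp only [map_mul, map_pow] at hβ hβ' ⊢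
    rw [hc1e, hc2e]
    have e1 := congrArg (Polynomial.aeval θ) hβ1
    have e2 := congrArg (Polynomial.aeval θ) hβ1'
    simp only [map_mul] at e1 e2
    rw [e1] at hβ
    rw [e2] at hβ'
    linear_combination (algebraMap B L h ^ (j0 * N) * Polynomial.aeval θ β1') * hβ -
      (algebraMap B L h ^ (j0 * N) * Polynomial.aeval θ β1) * hβ'
  have hnot : c1 ∉ P ∨ c2 ∉ P := by
    by_contra hcon
    push Not at hcon
    have : h ^ (j0 * N) * h ^ (j0 * N) ∈ P := by
      rw [← hsum]
      exact P.add_mem (P.mul_mem_right _ hcon.1) (P.mul_mem_right _ hcon.2)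
    rw [← pow_add] at this
    exact hP (Ideal.IsPrime.mem_of_pow_mem ‹_› _ this)
  have hc1' := S.cast hc1 (by push_cast; ring : _ = ((j0 * N * H.succ : ℕ) : ℤ))
  have hc2' := S.cast hc2 (by push_cast; ring : _ = ((j0 * N * H.succ : ℕ) : ℤ))
  rcases hnot with hn | hn
  · exact ⟨_, c1, c2, hc1', hc2', hn, Or.inr hrel.symm⟩
  · exact ⟨_, c2, c1, hc2', hc1', hn, Or.inl hrel⟩

end LSsec2


section Uniq
variable {k B : Type} [Field k] [IsAlgClosed k] [CharZero k] [CommRing B] [IsDomain B]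
  [CharZero B] [Algebra k B]

theorem exists_dom_val (L : Type) [Field L] [Algebra B L] [FaithfulSMul B L]
    (P : Ideal B) [P.IsPrime] : ∃ V : ValuationSubring L,
      (∀ b : B, V.valuation (algebraMap B L b) ≤ 1) ∧
      (∀ b : B, b ∉ P → V.valuation (algebraMap B L b) = 1) ∧
      (∀ b : B, b ∈ P → V.valuation (algebraMap B L b) < 1) := by
  have hu : ∀ y : P.primeCompl, IsUnit (algebraMap B L y) := by
    intro y
    have : (y : B) ≠ 0 := by
      intro h
      exact y.2 (h ▸ P.zero_mem)
    simpa using this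
  obtain ⟨V, hV, hloc⟩ := IsLocalRing.exists_factor_valuationRing
    (IsLocalization.lift (M := P.primeCompl) (S := Localization.AtPrime P) hu)
  have h1 : ∀ b : B, algebraMap B L b ∈ V := by
    intro b
    have := hV (algebraMap B _ b)
    rwa [IsLocalization.lift_eq] at this
  have key : ∀ b : B, V.valuation (algebraMap B L b) = 1 ↔ b ∉ P := by
    intro b
    rw [show algebraMap B L b = ((⟨algebraMap B L b, h1 b⟩ : V) : L) from rfl,
      ← V.valuation_eq_one_iff]
    have e : (⟨algebraMap B L b, h1 b⟩ : V) = (RingHom.codRestrict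
      (IsLocalization.lift (M := P.primeCompl) (S := Localization.AtPrime P) hu) V.toSubring hV)
        (algebraMap B _ b) := by
      apply Subtype.ext
      simp [IsLocalization.lift_eq]
    rw [e]
    constructor
    · intro h
      have := hloc.map_nonunit _ h
      exact (IsLocalization.AtPrime.isUnit_to_map_iff (Localization.AtPrime P) P b).1 this
    · intro h
      exact ((IsLocalization.AtPrime.isUnit_to_map_iff (Localization.AtPrime P) P b).2 h).map _
  refine ⟨V, fun b => (V.valuation_le_one_iff _).2 (h1 b), fun b hb => (key b).2 hb, ?_⟩
  intro b hb
  refine lt_of_le_of_ne ((V.valuation_le_one_iff _).2 (h1 b)) ?_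
  intro h
  exact (key b).1 h hb

theorem LS.uniq_aux (L : Type) [Field L] [Algebra B L] [Algebra k L] [IsScalarTower k B L]
    [FaithfulSMul B L] (S : LS k B) {H : ℕ} (hH : 0 < H) {h : B} (hh : h ∈ S.Gr H)
    (hDh : S.D h = 0) (hh0 : h ≠ 0) (P Q : Ideal B) [P.IsPrime] [Q.IsPrime]
    (hP : h ∈ P) (hQ : h ∈ Q) {d : ℕ} (hd : 0 < d) {u w : B} (hu : u ∈ S.Gr (d * H))
    (hw : w ∈ S.Gr (d * H)) (hwP : w ∉ P) (huP : u ∈ P) : u ∈ Q := by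
  by_contra huQ
  have hhL : algebraMap B L h ≠ 0 := by simpa using hh0
  obtain ⟨b0, j0, hb0, hT⟩ := S.theta L hH hh hDh hh0
  set θ : L := algebraMap B L b0 / algebraMap B L h ^ j0 with hθ
  obtain ⟨β, hβ⟩ := hT d u hu
  obtain ⟨ω, hω⟩ := hT d w hw
  have hu0 : algebraMap B L u ≠ 0 := by
    simp only [ne_eq, FaithfulSMul.algebraMap_eq_zero_iff]
    rintro rfl; exact huQ Q.zero_mem
  have hw0 : algebraMap B L w ≠ 0 := by
    simp only [ne_eq, FaithfulSMul.algebraMap_eq_zero_iff]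
    rintro rfl; exact hwP P.zero_mem
  have hβ0 : β ≠ 0 := by rintro rfl; simp at hβ; exact huQ (hβ ▸ Q.zero_mem)
  have hω0 : ω ≠ 0 := by rintro rfl; simp at hω; exact hwP (hω ▸ P.zero_mem)
  have triv : ∀ V : ValuationSubring L, (∀ b : B, V.valuation (algebraMap B L b) ≤ 1) →
      V.valuation.IsTrivialOn k := by
    intro V hV
    refine ⟨fun a ha => le_antisymm ?_ ?_⟩
    · rw [IsScalarTower.algebraMap_apply k B L]; exact hV _
    · have h2 := hV (algebraMap k B a⁻¹)
      rw [← IsScalarTower.algebraMap_apply k B L, map_inv₀, map_inv₀] at h2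
      have h3 : V.valuation (algebraMap k L a) ≠ 0 := by simpa using ha
      exact (inv_le_one₀ (zero_lt_iff.2 h3)).1 h2
  have main : ∀ (V : ValuationSubring L), (∀ b : B, V.valuation (algebraMap B L b) ≤ 1) →
      V.valuation (algebraMap B L h) < 1 → ∀ (q : Polynomial k),
      V.valuation (algebraMap B L h ^ d * Polynomial.aeval θ q) = 1 →
      1 < V.valuation θ := by
    intro V hV hVh q hq
    haveI := triv V hV
    by_contra hθ1
    push Not at hθ1
    have : V.valuation (Polynomial.aeval θ q) ≤ 1 := by
      rw [V.valuation_le_one_iff, Polynomial.aeval_eq_sum_range]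
      refine sum_mem fun i _ => ?_
      rw [Algebra.smul_def]
      refine MulMemClass.mul_mem ?_ (_root_.pow_mem ((V.valuation_le_one_iff _).1 hθ1) _)
      rw [IsScalarTower.algebraMap_apply k B L]
      exact (V.valuation_le_one_iff _).1 (hV _)
    have h2 : V.valuation (algebraMap B L h ^ d * Polynomial.aeval θ q) < 1 := by
      rw [map_mul, map_pow]
      exact mul_lt_one_of_lt_of_le (pow_lt_one₀ zero_le hVh hd.ne') this
    exact h2.ne hq
  have fin : ∀ (V : ValuationSubring L), (∀ b : B, V.valuation (algebraMap B L b) ≤ 1) →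
      1 < V.valuation θ → ∀ p q : Polynomial k, p ≠ 0 → q ≠ 0 →
      (V.valuation (algebraMap B L h ^ d * Polynomial.aeval θ p) ≤
       V.valuation (algebraMap B L h ^ d * Polynomial.aeval θ q) ↔ p.natDegree ≤ q.natDegree) := by
    intro V hV hVθ p q hp hq
    haveI := triv V hV
    have h0 : V.valuation (algebraMap B L h) ^ d ≠ 0 := by simpa using hhL |>.elim
    rw [map_mul, map_mul, map_pow,
      Polynomial.valuation_aeval_eq_valuation_X_pow_natDegree_of_one_lt_valuation_X _ hVθ hp,
      Polynomial.valuation_aeval_eq_valuation_X_pow_natDegree_of_one_lt_valuation_X _ hVθ hq]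
    rw [mul_le_mul_iff_right₀ (zero_lt_iff.2 h0), pow_le_pow_iff_right₀ hVθ]
  obtain ⟨V, hV1, hV2, hV3⟩ := exists_dom_val L P
  obtain ⟨W, hW1, hW2, hW3⟩ := exists_dom_val L Q
  have e1 := main V hV1 (hV3 h hP) ω (by rw [← hω]; exact hV2 w hwP)
  have e2 := main W hW1 (hW3 h hQ) β (by rw [← hβ]; exact hW2 u huQ)
  have e3 : ¬ ω.natDegree ≤ β.natDegree := by
    rw [← fin V hV1 e1 ω β hω0 hβ0, ← hω, ← hβ, hV2 w hwP, not_le]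
    exact hV3 u huP
  apply e3
  rw [← fin W hW1 e2 ω β hω0 hβ0, ← hω, ← hβ, hW2 u huQ]
  exact hW1 w

theorem LS.uniq (S : LS k B) {H : ℕ} (hH : 0 < H) {h : B} (hh : h ∈ S.Gr H)
    (hDh : S.D h = 0) (hh0 : h ≠ 0) (P Q : Ideal B) [P.IsPrime] [Q.IsPrime]
    (hP : h ∈ P) (hQ : h ∈ Q) {d e : ℕ} (hd : 0 < d) (he : 0 < e) {u w : B} (hu : u ∈ S.Gr d)
    (hw : w ∈ S.Gr e) (hwP : w ∉ P) (huP : u ∈ P) : u ∈ Q := by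
  have := S.uniq_aux (FractionRing B) hH hh hDh hh0 P Q hP hQ (d := d * e) (by positivity)
    (u := u ^ (e * H)) (w := w ^ (d * H)) (S.cast (S.pow_mem hu _) (by push_cast; ring))
    (S.cast (S.pow_mem hw _) (by push_cast; ring))
    (fun h => hwP (Ideal.IsPrime.mem_of_pow_mem ‹_› _ h))
    (Ideal.pow_mem_of_mem _ huP _ (by positivity))
  exact Ideal.IsPrime.mem_of_pow_mem ‹_› _ this

end Uniq


section Rlevel
variable {k : Type} [Field k]

/-- integer weight of a monomial -/
def wtz (m : Fin 3 →₀ ℕ) : ℤ := (Finsupp.weight w3 m : ℕ)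

theorem wtz_add (m n : Fin 3 →₀ ℕ) : wtz (m + n) = wtz m + wtz n := by
  simp [wtz]

theorem wtz_nonneg (m : Fin 3 →₀ ℕ) : 0 ≤ wtz m := by simp [wtz]

theorem wtz_single (j : Fin 3) : wtz (Finsupp.single j 1) = w3 j := by
  simp [wtz, Finsupp.weight_apply]

theorem w3_pos (j : Fin 3) : 0 < w3 j := by fin_cases j <;> simp [w3]

/-- polynomials all of whose monomials have weight in `T` -/
def GT (k : Type) [Field k] (T : Set ℤ) : Submodule k (MvPolynomial (Fin 3) k) where
  carrier := {r | ∀ m, coeff m r ≠ 0 → wtz m ∈ T}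
  add_mem' := by
    intro a b ha hb m hm
    by_cases h : coeff m a = 0
    · refine hb m ?_
      intro h'
      simp [h, h'] at hm
    · exact ha m h
  zero_mem' := by intro m hm; simp at hm
  smul_mem' := by
    intro c a ha m hm
    refine ha m ?_
    intro h
    simp [h] at hm

theorem mem_GT {T : Set ℤ} {r : MvPolynomial (Fin 3) k} :
    r ∈ GT k T ↔ ∀ m, coeff m r ≠ 0 → wtz m ∈ T := Iff.rfl

theorem GT_mono {T T' : Set ℤ} (h : T ⊆ T') {r : MvPolynomial (Fin 3) k} (hr : r ∈ GT k T) :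
    r ∈ GT k T' := fun m hm => h (hr m hm)

theorem GT_zero {T T' : Set ℤ} (h : ∀ x ∈ T, x ∉ T') {r : MvPolynomial (Fin 3) k}
    (hr : r ∈ GT k T) (hr' : r ∈ GT k T') : r = 0 := by
  ext m
  by_contra hm
  exact h _ (hr m (by simpa using hm)) (hr' m (by simpa using hm))

theorem GT_mul {T T' T'' : Set ℤ} (h : ∀ x ∈ T, ∀ y ∈ T', x + y ∈ T'')
    {u v : MvPolynomial (Fin 3) k} (hu : u ∈ GT k T) (hv : v ∈ GT k T') : u * v ∈ GT k T'' := by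
  intro m hm
  rw [coeff_mul] at hm
  obtain ⟨⟨a, b⟩, hab, hne⟩ := Finset.exists_ne_zero_of_sum_ne_zero hm
  rw [Finset.HasAntidiagonal.mem_antidiagonal] at hab
  simp only at hab hne
  rw [← hab, wtz_add]
  exact h _ (hu a (left_ne_zero_of_mul hne)) _ (hv b (right_ne_zero_of_mul hne))

theorem GT_monomial {T : Set ℤ} {m : Fin 3 →₀ ℕ} (c : k) (h : wtz m ∈ T) :
    monomial m c ∈ GT k T := by
  classical
  intro n hn
  rw [coeff_monomial] at hn
  split_ifs at hn with h'
  · rwa [← h']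
  · exact absurd rfl hn

theorem GT_iff_wh {n : ℕ} {r : MvPolynomial (Fin 3) k} :
    r ∈ GT k {(n : ℤ)} ↔ r.IsWeightedHomogeneous w3 n := by
  rw [mem_GT]
  constructor
  · intro h m hm
    have := h m hm
    simpa [wtz] using this
  · intro h m hm
    have := h hm
    simp [wtz, this]

theorem der_GT (E : Derivation k (MvPolynomial (Fin 3) k) (MvPolynomial (Fin 3) k))
    {T T' T'' : Set ℤ} (h : ∀ x ∈ T, ∀ y ∈ T', x + y ∈ T'')
    (hE : ∀ j m, coeff m (E (X j)) ≠ 0 → wtz m - w3 j ∈ T) {r : MvPolynomial (Fin 3) k}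
    (hr : r ∈ GT k T') : E r ∈ GT k T'' := by
  classical
  rw [r.as_sum, map_sum]
  refine Submodule.sum_mem _ fun m hm => ?_
  have hm' := hr m (by simpa using hm)
  have hE' : E = mkDerivation k (fun j => E (X j)) := derivation_ext (by simp)
  rw [hE', mkDerivation_monomial]
  refine Submodule.smul_mem _ _ (Submodule.sum_mem _ fun i hi => ?_)
  show monomial (m - Finsupp.single i 1) ((m i : ℕ) : k) * E (X i) ∈ GT k T''
  have hi' : m i ≠ 0 := by simpa using hi
  refine GT_mul (T := {wtz m - w3 i}) (T' := {x | x - w3 i ∈ T}) ?_ (GT_monomial _ ?_) (hE i)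
  · intro x hx y hy
    have := h _ hy _ hm'
    rw [Set.mem_singleton_iff.1 hx]
    convert this using 1; ring
  · have : m = (m - Finsupp.single i 1) + Finsupp.single i 1 := by
      rw [tsub_add_cancel_of_le]
      simpa [Nat.one_le_iff_ne_zero] using hi'
    have h2 := congrArg wtz this
    rw [wtz_add, wtz_single] at h2
    simp [h2]

/-- homogeneous component -/
def hcomp (d : ℤ) (p : MvPolynomial (Fin 3) k) : MvPolynomial (Fin 3) k :=
  ∑ m ∈ p.support.filter (fun m => wtz m = d), monomial m (coeff m p)

theorem coeff_cmp (d : ℤ) (p : MvPolynomial (Fin 3) k) (m : Fin 3 →₀ ℕ) :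
    coeff m (hcomp d p) = if wtz m = d then coeff m p else 0 := by
  classical
  simp only [hcomp, coeff_sum, coeff_monomial]
  rw [Finset.sum_ite_eq']
  simp only [Finset.mem_filter, mem_support_iff]
  by_cases h1 : wtz m = d <;> by_cases h2 : coeff m p = 0 <;> simp [h1, h2]

theorem cmp_mem (d : ℤ) (p : MvPolynomial (Fin 3) k) : hcomp d p ∈ GT k {d} := by
  intro m hm
  rw [coeff_cmp] at hm
  split_ifs at hm with h
  · exact h
  · exact absurd rfl hm

theorem cmp_eq_self {d : ℤ} {p : MvPolynomial (Fin 3) k} (hp : p ∈ GT k {d}) : hcomp d p = p := by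
  ext m
  rw [coeff_cmp]
  split_ifs with h
  · rfl
  · by_contra h'
    exact h (hp m (fun h => h' h.symm))

theorem cmp_add (d : ℤ) (p q : MvPolynomial (Fin 3) k) : hcomp d (p + q) = hcomp d p + hcomp d q := by
  ext m
  simp only [coeff_cmp, coeff_add]
  split_ifs <;> simp

theorem cmp_ne {d e : ℤ} (h : e ≠ d) {p : MvPolynomial (Fin 3) k} (hp : p ∈ GT k {d}) :
    hcomp e p = 0 := by
  ext m
  rw [coeff_cmp]
  split_ifs with h'
  · by_contra h''
    have := hp m (by simpa using h'')
    simp only [Set.mem_singleton_iff] at this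
    omega
  · simp

theorem cmp_sum {ι : Type} (d : ℤ) (s : Finset ι) (g : ι → MvPolynomial (Fin 3) k) :
    hcomp d (∑ i ∈ s, g i) = ∑ i ∈ s, hcomp d (g i) := by
  classical
  induction s using Finset.induction_on with
  | empty => simp [hcomp]
  | insert a s ha ih => rw [Finset.sum_insert ha, Finset.sum_insert ha, cmp_add, ih]

theorem cmp_mul {e d : ℤ} {p q : MvPolynomial (Fin 3) k} (hp : p ∈ GT k {e}) :
    hcomp (e + d) (p * q) = p * hcomp d q := by
  classical
  conv_lhs => rw [q.as_sum, Finset.mul_sum, cmp_sum]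
  rw [hcomp, Finset.mul_sum, Finset.sum_filter]
  refine Finset.sum_congr rfl fun m _ => ?_
  have h1 : p * monomial m (coeff m q) ∈ GT k {e + wtz m} :=
    GT_mul (T := {e}) (T' := {wtz m}) (by simp) hp (GT_monomial _ rfl)
  split_ifs with h
  · exact cmp_eq_self (by rw [← h]; exact h1)
  · exact cmp_ne (by omega) h1

theorem sum_cmp (p : MvPolynomial (Fin 3) k) :
    ∃ s : Finset ℤ, p = ∑ d ∈ s, hcomp d p := by
  classical
  refine ⟨p.support.image wtz, ?_⟩
  ext m
  rw [coeff_sum]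
  simp only [coeff_cmp, Finset.sum_ite_eq]
  split_ifs with h
  · rfl
  · by_contra h'
    exact h (Finset.mem_image_of_mem _ (by simpa using h'))

/-- auxiliary substitution -/
def phiT : MvPolynomial (Fin 3) k →ₐ[k] Polynomial (MvPolynomial (Fin 3) k) :=
  aeval (fun j => Polynomial.C (X j) * Polynomial.X ^ (w3 j))

theorem phiT_monomial (m : Fin 3 →₀ ℕ) (c : k) :
    phiT (monomial m c) = Polynomial.C (monomial m c) * Polynomial.X ^ (Finsupp.weight w3 m) := by
  rw [phiT, aeval_monomial, Finsupp.prod_fintype _ _ (by simp), Finsupp.weight_apply,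
    Finsupp.sum_fintype _ _ (by simp), monomial_eq, Finsupp.prod_fintype _ _ (by simp)]
  simp only [map_mul, mul_pow, Finset.prod_mul_distrib, map_prod, map_pow, ← pow_mul,
    Finset.prod_pow_eq_pow_sum, smul_eq_mul]
  simp only [mul_comm (w3 _)]
  rw [mul_assoc]
  rfl

theorem phiT_coeff (r : MvPolynomial (Fin 3) k) (n : ℕ) : (phiT r).coeff n = hcomp n r := by
  classical
  conv_lhs => rw [r.as_sum, map_sum, Polynomial.finset_sum_coeff]
  rw [hcomp, Finset.sum_filter]
  refine Finset.sum_congr rfl fun m _ => ?_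
  rw [phiT_monomial, Polynomial.coeff_C_mul_X_pow]
  simp only [wtz, Nat.cast_inj, eq_comm]

theorem phiT_zero {r : MvPolynomial (Fin 3) k} (h : phiT r = 0) : r = 0 := by
  ext m
  have := congrArg (fun q => coeff m (Polynomial.coeff q (Finsupp.weight w3 m))) h
  simpa [phiT_coeff, coeff_cmp, wtz] using this

theorem hom_factor {u v : MvPolynomial (Fin 3) k} {d : ℤ} (h : u * v ∈ GT k {d})
    (h0 : u * v ≠ 0) : ∃ a b : ℕ, u ∈ GT k {(a : ℤ)} ∧ v ∈ GT k {(b : ℤ)} ∧ (a : ℤ) + b = d := by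
  have hd : 0 ≤ d := by
    obtain ⟨m, hm⟩ := exists_coeff_ne_zero h0
    have := h m hm
    rw [← Set.mem_singleton_iff.1 this]
    exact wtz_nonneg m
  lift d to ℕ using hd
  have e : phiT (u * v) = Polynomial.C (u * v) * Polynomial.X ^ d := by
    ext1 n
    rw [phiT_coeff, Polynomial.coeff_C_mul_X_pow]
    split_ifs with hn
    · rw [hn]; exact cmp_eq_self h
    · exact cmp_ne (by exact_mod_cast hn) h
  have hu : phiT u ≠ 0 := fun h => left_ne_zero_of_mul h0 (phiT_zero h)
  have hv : phiT v ≠ 0 := fun h => right_ne_zero_of_mul h0 (phiT_zero h)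
  have h1 := congrArg Polynomial.natDegree e
  have h2 := congrArg Polynomial.natTrailingDegree e
  rw [map_mul, Polynomial.natDegree_mul hu hv, Polynomial.natDegree_C_mul_X_pow _ _ h0] at h1
  rw [map_mul, Polynomial.natTrailingDegree_mul hu hv, Polynomial.natTrailingDegree_mul_X_pow
    (by simpa using h0), Polynomial.natTrailingDegree_C] at h2
  have h3 := Polynomial.natTrailingDegree_le_natDegree (phiT u)
  have h4 := Polynomial.natTrailingDegree_le_natDegree (phiT v)
  have key : ∀ r : MvPolynomial (Fin 3) k,
      (phiT r).natTrailingDegree = (phiT r).natDegree → r ∈ GT k {((phiT r).natDegree : ℤ)} := by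
    intro r hr m hm
    by_contra hne
    have : (phiT r).coeff (Finsupp.weight w3 m) = 0 := by
      rcases lt_or_gt_of_ne (fun h => hne (by simp [wtz, h]) :
        Finsupp.weight w3 m ≠ (phiT r).natDegree) with h | h
      · exact Polynomial.coeff_eq_zero_of_lt_natTrailingDegree (by omega)
      · exact Polynomial.coeff_eq_zero_of_natDegree_lt h
    rw [phiT_coeff] at this
    have := congrArg (coeff m) this
    rw [coeff_cmp] at this
    simp [wtz] at this
    exact hm this
  exact ⟨_, _, key u (by omega), key v (by omega), by exact_mod_cast h1⟩

end Rlevel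


section Homog
variable {k : Type} [Field k] [CharZero k]

/-- homogeneous derivation of degree `N` -/
def IsHomD (D : Derivation k (MvPolynomial (Fin 3) k) (MvPolynomial (Fin 3) k)) (N : ℤ) : Prop :=
  ∀ j, D (X j) ∈ GT k {N + w3 j}

theorem IsHomD.mem {D : Derivation k (MvPolynomial (Fin 3) k) (MvPolynomial (Fin 3) k)} {N : ℤ}
    (h : IsHomD D N) {d : ℤ} {r : MvPolynomial (Fin 3) k} (hr : r ∈ GT k {d}) :
    D r ∈ GT k {d + N} := by
  refine der_GT D (T := {N}) (T' := {d}) ?_ ?_ hr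
  · simp [add_comm]
  · intro j m hm
    have := h j m hm
    simp only [Set.mem_singleton_iff] at *
    omega

theorem IsHomD.iter_mem {D : Derivation k (MvPolynomial (Fin 3) k) (MvPolynomial (Fin 3) k)} {N : ℤ}
    (h : IsHomD D N) {d : ℤ} {r : MvPolynomial (Fin 3) k} (hr : r ∈ GT k {d}) (n : ℕ) :
    (⇑D)^[n] r ∈ GT k {d + n * N} := by
  induction n with
  | zero => simpa using hr
  | succ n ih =>
    rw [Function.iterate_succ_apply']
    have := h.mem ih
    convert this using 3
    push_cast; ring

theorem exists_X_ne {D : Derivation k (MvPolynomial (Fin 3) k) (MvPolynomial (Fin 3) k)}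
    (h : D ≠ 0) : ∃ j, D (X j) ≠ 0 := by
  by_contra hc
  push Not at hc
  exact h (derivation_ext (by simpa using hc))

theorem lnd_of_hom {D : Derivation k (MvPolynomial (Fin 3) k) (MvPolynomial (Fin 3) k)}
    (h : ∀ m c, ∃ n, (⇑D)^[n] (monomial m c) = 0) : IsLND D := by
  intro r
  induction r using MvPolynomial.induction_on' with
  | monomial m c => exact h m c
  | add p q hp hq =>
    obtain ⟨a, ha⟩ := hp
    obtain ⟨b, hb⟩ := hq
    refine ⟨a + b, ?_⟩
    rw [iter_add, iter_zero_of_le D ha (by omega), iter_zero_of_le D hb (by omega), add_zero]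

theorem homogenize {D : Derivation k (MvPolynomial (Fin 3) k) (MvPolynomial (Fin 3) k)}
    (hD : IsLND D) (hD0 : D ≠ 0) {f : MvPolynomial (Fin 3) k} {d : ℤ} (hf : f ∈ GT k {d})
    (hDf : D (D f) = 0) :
    ∃ (N : ℤ) (D' : Derivation k (MvPolynomial (Fin 3) k) (MvPolynomial (Fin 3) k)),
      IsLND D' ∧ D' ≠ 0 ∧ IsHomD D' N ∧ D' (D' f) = 0 := by
  classical
  obtain ⟨j₁, hj₁⟩ := exists_X_ne hD0
  obtain ⟨m₁, hm₁⟩ := exists_coeff_ne_zero hj₁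
  let F : Finset ℤ := Finset.univ.biUnion fun j : Fin 3 =>
    (D (X j)).support.image fun m => wtz m - w3 j
  have hFmem : ∀ j m, coeff m (D (X j)) ≠ 0 → wtz m - w3 j ∈ F := by
    intro j m hm
    simp only [F, Finset.mem_biUnion, Finset.mem_univ, true_and, Finset.mem_image]
    exact ⟨j, m, by simpa using hm, rfl⟩
  have hFne : F.Nonempty := ⟨_, hFmem j₁ m₁ hm₁⟩
  let N := F.max' hFne
  have hN : ∀ j m, coeff m (D (X j)) ≠ 0 → wtz m - w3 j ≤ N :=
    fun j m hm => F.le_max' _ (hFmem j m hm)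
  obtain ⟨j₂, m₂, hm₂, hNeq⟩ : ∃ j m, coeff m (D (X j)) ≠ 0 ∧ wtz m - w3 j = N := by
    have := F.max'_mem hFne
    simp only [F, Finset.mem_biUnion, Finset.mem_univ, true_and, Finset.mem_image] at this
    obtain ⟨j, m, hm, h⟩ := this
    exact ⟨j, m, by simpa using hm, h⟩
  let E : Derivation k (MvPolynomial (Fin 3) k) (MvPolynomial (Fin 3) k) :=
    mkDerivation k fun j => hcomp (N + w3 j) (D (X j))
  have hE : IsHomD E N := by
    intro j
    simp only [E, mkDerivation_X]
    exact cmp_mem _ _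
  have key : ∀ (e : ℤ) (r : MvPolynomial (Fin 3) k), r ∈ GT k {e} → ∀ n : ℕ,
      (⇑D)^[n] r - (⇑E)^[n] r ∈ GT k (Set.Iio (e + n * N)) := by
    intro e r hr n
    induction n with
    | zero => simp
    | succ n ih =>
      rw [Function.iterate_succ_apply', Function.iterate_succ_apply']
      have : D ((⇑D)^[n] r) - E ((⇑E)^[n] r) = D ((⇑D)^[n] r - (⇑E)^[n] r) +
          (D - E) ((⇑E)^[n] r) := by
        simp
      rw [this]
      refine Submodule.add_mem _ ?_ ?_
      · refine der_GT D (T := Set.Iic N) ?_ hN ih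
        intro x hx y hy
        simp only [Set.mem_Iic, Set.mem_Iio] at *
        push_cast
        linarith
      · refine der_GT (D - E) (T := Set.Iio N) ?_ ?_ (hE.iter_mem hr n)
        · intro x hx y hy
          simp only [Set.mem_Iio, Set.mem_singleton_iff] at *
          push_cast
          linarith
        · intro j m hm
          simp only [E, Derivation.sub_apply, mkDerivation_X, coeff_sub, coeff_cmp] at hm
          split_ifs at hm with h
          · simp at hm
          · have := hN j m (by simpa using hm)
            simp only [Set.mem_Iio]
            omega
  have key2 : ∀ (e : ℤ) (r : MvPolynomial (Fin 3) k), r ∈ GT k {e} → ∀ n : ℕ,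
      (⇑D)^[n] r = 0 → (⇑E)^[n] r = 0 := by
    intro e r hr n h
    have h1 := key e r hr n
    rw [h, zero_sub, Submodule.neg_mem_iff] at h1
    refine GT_zero (T := Set.Iio (e + n * N)) ?_ h1 (hE.iter_mem hr n)
    intro x hx hx'
    simp only [Set.mem_Iio, Set.mem_singleton_iff] at *
    omega
  refine ⟨N, E, lnd_of_hom ?_, ?_, hE, ?_⟩
  · intro m c
    obtain ⟨n, hn⟩ := hD (monomial m c)
    exact ⟨n, key2 (wtz m) _ (GT_monomial c rfl) n hn⟩
  · intro h0
    have : coeff m₂ (E (X j₂)) = 0 := by simp [h0]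
    simp only [E, mkDerivation_X, coeff_cmp] at this
    rw [if_pos (by omega)] at this
    exact hm₂ this
  · exact key2 d f hf 2 hDf

theorem minimalD {D : Derivation k (MvPolynomial (Fin 3) k) (MvPolynomial (Fin 3) k)}
    (hD : IsLND D) (hD0 : D ≠ 0) {f : MvPolynomial (Fin 3) k} {d : ℤ} (hf : f ∈ GT k {d})
    (hDf : D (D f) = 0) :
    ∃ (N : ℤ) (D' : Derivation k (MvPolynomial (Fin 3) k) (MvPolynomial (Fin 3) k)),
      IsLND D' ∧ D' ≠ 0 ∧ IsHomD D' N ∧ D' (D' f) = 0 ∧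
      ∀ (p : MvPolynomial (Fin 3) k) (e : ℤ), p ≠ 0 → p ∈ GT k {e} → 0 < e →
        ∃ j, ¬ p ∣ D' (X j) := by
  classical
  let Pr : ℤ → Prop := fun N =>
    ∃ D' : Derivation k (MvPolynomial (Fin 3) k) (MvPolynomial (Fin 3) k),
      IsLND D' ∧ D' ≠ 0 ∧ IsHomD D' N ∧ D' (D' f) = 0
  have hbd : ∀ N, Pr N → -3 ≤ N := by
    rintro N ⟨D', -, h0, hh, -⟩
    obtain ⟨j, hj⟩ := exists_X_ne h0
    obtain ⟨m, hm⟩ := exists_coeff_ne_zero hj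
    have h1 := hh j m hm
    have h2 := wtz_nonneg m
    have h3 : w3 j ≤ 3 := by fin_cases j <;> simp [w3]
    simp only [Set.mem_singleton_iff] at h1
    omega
  obtain ⟨N, ⟨D', hl, h0, hh, hff⟩, hmin⟩ := Int.exists_least_of_bdd ⟨-3, hbd⟩
    (homogenize hD hD0 hf hDf)
  refine ⟨N, D', hl, h0, hh, hff, ?_⟩
  intro p e hp0 hp he
  by_contra hdvd
  push Not at hdvd
  choose q hq using hdvd
  let E : Derivation k (MvPolynomial (Fin 3) k) (MvPolynomial (Fin 3) k) := mkDerivation k q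
  have hDE : D' = p • E := derivation_ext (by intro j; simp [E, hq])
  have hDE' : ∀ r, D' r = p * E r := by intro r; rw [hDE]; rfl
  have hDp : D' p = 0 := ker_of_dvd hl hp0 (fun r => ⟨_, hDE' r⟩)
  have hit : ∀ n r, (⇑D')^[n] r = p ^ n * (⇑E)^[n] r := by
    intro n r
    induction n with
    | zero => simp
    | succ n ih =>
      rw [Function.iterate_succ_apply', Function.iterate_succ_apply', ih, Derivation.leibniz,
        Derivation.leibniz_pow, hDp, hDE']
      simp only [smul_zero, smul_eq_mul, mul_zero, add_zero]
      ring
  have hEl : ∀ n r, (⇑D')^[n] r = 0 → (⇑E)^[n] r = 0 := by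
    intro n r h
    rw [hit] at h
    exact (mul_eq_zero.1 h).resolve_left (pow_ne_zero _ hp0)
  have : N ≤ N - e := by
    refine hmin (N - e) ⟨E, ?_, ?_, ?_, hEl 2 f hff⟩
    · intro b
      obtain ⟨n, hn⟩ := hl b
      exact ⟨n, hEl n b hn⟩
    · rintro hE0
      exact h0 (by rw [hDE, hE0]; simp)
    · intro j
      simp only [E, mkDerivation_X]
      rcases eq_or_ne (q j) 0 with hqj | hqj
      · rw [hqj]; exact Submodule.zero_mem _
      have h1 := hh j
      rw [hq] at h1
      obtain ⟨a, b, ha, hb, hab⟩ := hom_factor h1 (mul_ne_zero hp0 hqj)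
      have : (a : ℤ) = e := by
        obtain ⟨m, hm⟩ := exists_coeff_ne_zero hp0
        have e1 := ha m hm
        have e2 := hp m hm
        simp only [Set.mem_singleton_iff] at e1 e2
        omega
      rwa [show N - e + w3 j = b by omega]
  omega

end Homog


section QuotLS
variable {k : Type} [Field k] [IsAlgClosed k] [CharZero k]

theorem GT_zero_const {r : MvPolynomial (Fin 3) k} (hr : r ∈ GT k {0}) : ∃ c : k, r = C c := by
  classical
  refine ⟨coeff 0 r, ?_⟩
  ext m
  rw [coeff_C]
  split_ifs with h
  · rw [← h]
  · by_contra h'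
    have h1 := hr m h'
    simp only [Set.mem_singleton_iff] at h1
    apply h
    by_contra hm
    obtain ⟨i, hi⟩ : ∃ i, m i ≠ 0 := by
      by_contra hc
      push Not at hc
      exact hm (by ext i; simp [hc i])
    have : m = (m - Finsupp.single i 1) + Finsupp.single i 1 := by
      rw [tsub_add_cancel_of_le]
      simpa [Nat.one_le_iff_ne_zero] using hi
    have h2 := congrArg wtz this
    rw [wtz_add, wtz_single] at h2
    have := wtz_nonneg (m - Finsupp.single i 1)
    have := w3_pos i
    omega

theorem GT_neg {d : ℤ} (hd : d < 0) {r : MvPolynomial (Fin 3) k} (hr : r ∈ GT k {d}) : r = 0 := by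
  by_contra h
  obtain ⟨m, hm⟩ := exists_coeff_ne_zero h
  have h1 := hr m hm
  have := wtz_nonneg m
  simp only [Set.mem_singleton_iff] at h1
  omega

theorem GT_X (j : Fin 3) : (X j : MvPolynomial (Fin 3) k) ∈ GT k {(w3 j : ℤ)} :=
  GT_monomial 1 (wtz_single j)

theorem GT_sum_dvd {e : ℤ} {p : MvPolynomial (Fin 3) k} (hp : p ∈ GT k {e}) (s : Finset ℤ)
    (r : ℤ → MvPolynomial (Fin 3) k) (hr : ∀ i, r i ∈ GT k {i}) (h : p ∣ ∑ i ∈ s, r i) :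
    ∀ i ∈ s, p ∣ r i := by
  classical
  intro i hi
  obtain ⟨q, hq⟩ := h
  refine ⟨hcomp (i - e) q, ?_⟩
  rw [← cmp_mul hp, show e + (i - e) = i by ring, ← hq, cmp_sum,
    Finset.sum_eq_single i]
  · exact (cmp_eq_self (hr i)).symm
  · intro b _ hb
    exact cmp_ne hb.symm (hr b)
  · exact fun h => absurd hi h

theorem quotD_aux (D : Derivation k (MvPolynomial (Fin 3) k) (MvPolynomial (Fin 3) k))
    {p : MvPolynomial (Fin 3) k} (hDp : D p = 0) (x : MvPolynomial (Fin 3) k)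
    (hx : Ideal.Quotient.mkₐ k (Ideal.span {p}) x = 0) :
    Ideal.Quotient.mkₐ k (Ideal.span {p}) (D x) = 0 := by
  rw [Ideal.Quotient.mkₐ_eq_mk, Ideal.Quotient.eq_zero_iff_dvd] at hx ⊢
  obtain ⟨q, rfl⟩ := hx
  rw [Derivation.leibniz, hDp]
  simp

/-- induced derivation -/
def quotD (D : Derivation k (MvPolynomial (Fin 3) k) (MvPolynomial (Fin 3) k))
    {p : MvPolynomial (Fin 3) k} (hDp : D p = 0) :
    Derivation k (MvPolynomial (Fin 3) k ⧸ Ideal.span {p})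
      (MvPolynomial (Fin 3) k ⧸ Ideal.span {p}) :=
  Derivation.liftOfSurjective (f := Ideal.Quotient.mkₐ k (Ideal.span {p}))
    (Ideal.Quotient.mkₐ_surjective _ _) (d := D) (quotD_aux D hDp)

theorem quotD_mk (D : Derivation k (MvPolynomial (Fin 3) k) (MvPolynomial (Fin 3) k))
    {p : MvPolynomial (Fin 3) k} (hDp : D p = 0) (r : MvPolynomial (Fin 3) k) :
    quotD D hDp (Ideal.Quotient.mk _ r) = Ideal.Quotient.mk _ (D r) :=
  Derivation.liftOfSurjective_apply _ (quotD_aux D hDp) r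

theorem quotD_iter (D : Derivation k (MvPolynomial (Fin 3) k) (MvPolynomial (Fin 3) k))
    {p : MvPolynomial (Fin 3) k} (hDp : D p = 0) (n : ℕ) (r : MvPolynomial (Fin 3) k) :
    (⇑(quotD D hDp))^[n] (Ideal.Quotient.mk _ r) = Ideal.Quotient.mk _ ((⇑D)^[n] r) := by
  induction n with
  | zero => rfl
  | succ n ih => rw [Function.iterate_succ_apply', Function.iterate_succ_apply', ih, quotD_mk]

theorem no3_quot {p : MvPolynomial (Fin 3) k} (hp : Prime p)
    (x : Option (Fin 2) → MvPolynomial (Fin 3) k ⧸ Ideal.span {p}) :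
    ¬ AlgebraicIndependent k x := by
  intro hx
  have hsurj := Ideal.Quotient.mkₐ_surjective k (Ideal.span {p})
  choose y hy using fun i => hsurj (x i)
  have hxy : x = (Ideal.Quotient.mkₐ k (Ideal.span {p})) ∘ y := by ext i; simp [← hy]
  have hyi : AlgebraicIndependent k y := by
    rw [hxy] at hx
    exact AlgebraicIndependent.of_comp _ hx
  have htr : Transcendental (Algebra.adjoin k (Set.range y)) p := by
    have key : ∀ c : Algebra.adjoin k (Set.range y), p ∣ (c : MvPolynomial (Fin 3) k) → c = 0 := by
      rintro ⟨c, hc⟩ hpc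
      have hc' := hc
      rw [Algebra.adjoin_range_eq_range_aeval] at hc
      obtain ⟨s, rfl⟩ := hc
      have h1 : aeval x s = 0 := by
        rw [hxy]
        have := (Ideal.Quotient.eq_zero_iff_dvd _ _).2 hpc
        rw [← Ideal.Quotient.mkₐ_eq_mk k] at this
        rw [← this]
        exact (MvPolynomial.comp_aeval_apply (f := y) (Ideal.Quotient.mkₐ k (Ideal.span {p})) s).symm
      have h2 : s = 0 := by
        rw [algebraicIndependent_iff] at hx
        exact hx s h1
      apply Subtype.ext
      simp [h2]
    rw [transcendental_iff]
    intro q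
    induction hn : q.natDegree using Nat.strong_induction_on generalizing q with
    | _ n ih =>
      intro hq
      have h0 : q.coeff 0 = 0 := by
        apply key
        rw [← Polynomial.divX_mul_X_add q] at hq
        simp only [map_add, map_mul, Polynomial.aeval_X, Polynomial.aeval_C] at hq
        refine ⟨- Polynomial.aeval p q.divX, ?_⟩
        have : algebraMap (Algebra.adjoin k (Set.range y)) (MvPolynomial (Fin 3) k) (q.coeff 0)
          = (q.coeff 0 : MvPolynomial (Fin 3) k) := rfl
        rw [this] at hq
        linear_combination hq
      have hdiv : q = q.divX * Polynomial.X := by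
        conv_lhs => rw [← Polynomial.divX_mul_X_add q, h0]
        simp
      by_cases hn0 : n = 0
      · rw [Polynomial.eq_C_of_natDegree_eq_zero (hn.trans hn0), h0, map_zero]
      · have h1 : q.divX = 0 := by
          refine ih _ ?_ q.divX rfl ?_
          · rw [Polynomial.natDegree_divX_eq_natDegree_tsub_one]; omega
          · rw [hdiv] at hq
            simp only [map_mul, Polynomial.aeval_X] at hq
            exact (mul_eq_zero.1 hq).resolve_right hp.ne_zero
        rw [hdiv, h1, zero_mul]
  have h4 := (hyi.option_iff_transcendental p).2 htr
  have h5 := h4.cardinalMk_le_trdeg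
  rw [MvPolynomial.trdeg_of_isDomain] at h5
  simp at h5
  exact absurd h5 (by norm_cast)

/-- the graded structure on the quotient by a homogeneous prime in the kernel -/
def quotLS {D : Derivation k (MvPolynomial (Fin 3) k) (MvPolynomial (Fin 3) k)} {N : ℤ}
    (hl : IsLND D) (hh : IsHomD D N) {p : MvPolynomial (Fin 3) k} (hp : Prime p) {e : ℤ}
    (hpe : p ∈ GT k {e}) (hDp : D p = 0) (hdvd : ∃ j, ¬ p ∣ D (X j)) :
    LS k (MvPolynomial (Fin 3) k ⧸ Ideal.span {p}) where
  Gr d := (GT k {d}).map (Ideal.Quotient.mkₐ k (Ideal.span {p})).toLinearMap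
  one_mem := ⟨1, GT_monomial (1 : k) (by simp [wtz]), by simp⟩
  mul_mem := by
    rintro d e _ _ ⟨u, hu, rfl⟩ ⟨v, hv, rfl⟩
    exact ⟨u * v, GT_mul (T := {d}) (T' := {e}) (by simp) hu hv, by simp⟩
  zero_deg := by
    rintro _ ⟨u, hu, rfl⟩
    obtain ⟨c, rfl⟩ := GT_zero_const hu
    exact ⟨c, rfl⟩
  neg_deg := by
    rintro d _ hd ⟨u, hu, rfl⟩
    rw [GT_neg hd hu, map_zero]
  indep := by
    intro s g hg hs i hi
    choose r hr hr' using hg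
    have hg' : ∀ i, Ideal.Quotient.mk (Ideal.span {p}) (r i) = g i := hr'
    rw [← hg', Ideal.Quotient.eq_zero_iff_dvd]
    refine GT_sum_dvd hpe s r hr ?_ i hi
    rw [← Ideal.Quotient.eq_zero_iff_dvd, map_sum, ← hs]
    simp [hg']
  D := quotD D hDp
  δ := N
  D_mem := by
    rintro d _ ⟨u, hu, rfl⟩
    exact ⟨D u, hh.mem hu, (quotD_mk D hDp u).symm⟩
  lnd := by
    intro b
    obtain ⟨r, rfl⟩ := Ideal.Quotient.mk_surjective b
    obtain ⟨n, hn⟩ := hl r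
    exact ⟨n, by rw [quotD_iter, hn, map_zero]⟩
  slice := by
    obtain ⟨j, hj⟩ := hdvd
    refine ⟨w3 j, Ideal.Quotient.mk _ (X j), ⟨X j, GT_X j, rfl⟩, ?_⟩
    rw [quotD_mk, ne_eq, Ideal.Quotient.eq_zero_iff_dvd]
    exact hj
  no3 := no3_quot hp

theorem quot_isDomain {p : MvPolynomial (Fin 3) k} (hp : Prime p) :
    IsDomain (MvPolynomial (Fin 3) k ⧸ Ideal.span {p}) := by
  have : (Ideal.span {p}).IsPrime := (Ideal.span_singleton_prime hp.ne_zero).2 hp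
  infer_instance

theorem quot_charZero {p : MvPolynomial (Fin 3) k} (hp : Prime p) :
    CharZero (MvPolynomial (Fin 3) k ⧸ Ideal.span {p}) := by
  have := quot_isDomain hp
  exact charZero_of_injective_algebraMap (FaithfulSMul.algebraMap_injective k _)

theorem mk_zero_iff {p r : MvPolynomial (Fin 3) k} :
    Ideal.Quotient.mk (Ideal.span {p}) r = 0 ↔ p ∣ r := Ideal.Quotient.eq_zero_iff_dvd _ _

end QuotLS


section Core
variable {k : Type} [Field k] [IsAlgClosed k] [CharZero k]

/-- standing assumptions on the derivation -/
structure Ctx (D : Derivation k (MvPolynomial (Fin 3) k) (MvPolynomial (Fin 3) k)) (N : ℤ) :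
    Prop where
  hl : IsLND D
  hh : IsHomD D N
  hN : -3 ≤ N
  hdvd : ∀ (p : MvPolynomial (Fin 3) k) (e : ℤ), p ≠ 0 → p ∈ GT k {e} → 0 < e → ∃ j, ¬ p ∣ D (X j)

/-- relevant homogeneous primes -/
structure HP (P : Ideal (MvPolynomial (Fin 3) k)) : Prop where
  prime : P.IsPrime
  hom : ∀ r ∈ P, ∀ d, hcomp d r ∈ P
  rel : ∃ (e : ℕ) (w : MvPolynomial (Fin 3) k), 0 < e ∧ w ∈ GT k {(e : ℤ)} ∧ w ∉ P

/-- valuation property modulo `f` -/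
def VR (f : MvPolynomial (Fin 3) k) (P : Ideal (MvPolynomial (Fin 3) k)) : Prop :=
  ∀ (d : ℕ) (b b' : MvPolynomial (Fin 3) k), b ∈ GT k {(d : ℤ)} → b' ∈ GT k {(d : ℤ)} →
    ∃ (e : ℕ) (v c : MvPolynomial (Fin 3) k), v ∈ GT k {(e : ℤ)} ∧ c ∈ GT k {(e : ℤ)} ∧ v ∉ P ∧
      (f ∣ b * v - b' * c ∨ f ∣ b' * v - b * c)

theorem const_mem {P : Ideal (MvPolynomial (Fin 3) k)} (hP : P.IsPrime)
    {r : MvPolynomial (Fin 3) k} (hr : r ∈ GT k {0}) (h : r ∈ P) : r = 0 := by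
  obtain ⟨c, rfl⟩ := GT_zero_const hr
  by_contra h0
  have hc : c ≠ 0 := by rintro rfl; simp at h0
  apply hP.ne_top
  rw [Ideal.eq_top_iff_one]
  have := P.mul_mem_left (C c⁻¹) h
  rwa [← C_mul, inv_mul_cancel₀ hc, C_1] at this

theorem HP.le {P Q : Ideal (MvPolynomial (Fin 3) k)} (hP : HP P)
    (h : ∀ (d : ℕ) (u : MvPolynomial (Fin 3) k), 0 < d → u ∈ GT k {(d : ℤ)} → u ∈ P → u ∈ Q) :
    P ≤ Q := by
  intro r hr
  obtain ⟨s, hs⟩ := sum_cmp r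
  rw [hs]
  refine Ideal.sum_mem _ fun d _ => ?_
  have h1 := hP.hom r hr d
  have h2 := cmp_mem d r
  rcases lt_trichotomy d 0 with hd | hd | hd
  · rw [GT_neg hd h2]; exact Q.zero_mem
  · subst hd
    rw [const_mem hP.prime h2 h1]; exact Q.zero_mem
  · lift d to ℕ using hd.le
    exact h d _ (by exact_mod_cast hd) h2 h1

variable {D : Derivation k (MvPolynomial (Fin 3) k) (MvPolynomial (Fin 3) k)} {N : ℤ}

theorem Ctx.uniq (hC : Ctx D N) {p h : MvPolynomial (Fin 3) k} {e H : ℕ} (hp : Prime p)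
    (hpe : p ∈ GT k {(e : ℤ)}) (he : 0 < e) (hDp : D p = 0) (hH : 0 < H)
    (hh : h ∈ GT k {(H : ℤ)}) (hDh : p ∣ D h) (hph : ¬ p ∣ h)
    {P Q : Ideal (MvPolynomial (Fin 3) k)} (hP : HP P) (hQ : Q.IsPrime)
    (hpP : p ∈ P) (hpQ : p ∈ Q) (hhP : h ∈ P) (hhQ : h ∈ Q) : P ≤ Q := by
  have := quot_isDomain hp
  have := quot_charZero hp
  let S := quotLS hC.hl hC.hh hp hpe hDp (hC.hdvd p e hp.ne_zero hpe (by exact_mod_cast he))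
  let π := Ideal.Quotient.mk (Ideal.span {p})
  have hπ : Function.Surjective π := Ideal.Quotient.mk_surjective
  have hIP : Ideal.span {p} ≤ P := (Ideal.span_singleton_le_iff_mem _).2 hpP
  have hIQ : Ideal.span {p} ≤ Q := (Ideal.span_singleton_le_iff_mem _).2 hpQ
  have hPp := hP.prime
  have : (P.map π).IsPrime := Ideal.map_isPrime_of_surjective hπ (by rwa [Ideal.mk_ker])
  have : (Q.map π).IsPrime := Ideal.map_isPrime_of_surjective hπ (by rwa [Ideal.mk_ker])
  obtain ⟨ew, w, hew, hw, hwP⟩ := hP.rel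
  refine hP.le fun d u hd hu huP => ?_
  have := S.uniq hH (h := π h) ⟨h, hh, rfl⟩ ((quotD_mk D hDp h).trans (mk_zero_iff.2 hDh))
    (fun h0 => hph (mk_zero_iff.1 h0)) (P.map π) (Q.map π) (Ideal.mem_map_of_mem π hhP)
    (Ideal.mem_map_of_mem π hhQ) hd hew (u := π u) (w := π w) ⟨u, hu, rfl⟩ ⟨w, hw, rfl⟩
    (by rwa [Ideal.mem_quotient_iff_mem hIP]) (Ideal.mem_map_of_mem π huP)
  rwa [Ideal.mem_quotient_iff_mem hIQ] at this

theorem Ctx.kpow (hC : Ctx D N) {p U V : MvPolynomial (Fin 3) k} {e a b : ℕ} (hp : Prime p)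
    (hpe : p ∈ GT k {(e : ℤ)}) (he : 0 < e) (hDp : D p = 0)
    (hU : U ∈ GT k {(a : ℤ)}) (hV : V ∈ GT k {(b : ℤ)}) (hDU : p ∣ D U) (hDV : p ∣ D V)
    (hpU : ¬ p ∣ U) (hpV : ¬ p ∣ V) : ∃ c : k, p ∣ U ^ b - C c * V ^ a := by
  have := quot_isDomain hp
  have := quot_charZero hp
  let S := quotLS hC.hl hC.hh hp hpe hDp (hC.hdvd p e hp.ne_zero hpe (by exact_mod_cast he))
  let π := Ideal.Quotient.mk (Ideal.span {p})
  obtain ⟨c, -, hc⟩ := S.kpow (U := π U) (V := π V) ⟨U, hU, rfl⟩ ⟨V, hV, rfl⟩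
    ((quotD_mk D hDp U).trans (mk_zero_iff.2 hDU)) ((quotD_mk D hDp V).trans (mk_zero_iff.2 hDV))
    (fun h0 => hpU (mk_zero_iff.1 h0)) (fun h0 => hpV (mk_zero_iff.1 h0))
  refine ⟨c, mk_zero_iff.1 ?_⟩
  rw [map_sub, map_mul, map_pow, map_pow, sub_eq_zero]
  exact hc

theorem Ctx.vr1 (hC : Ctx D N) {p h : MvPolynomial (Fin 3) k} {e H : ℕ} (hp : Prime p)
    (hpe : p ∈ GT k {(e : ℤ)}) (he : 0 < e) (hDp : D p = 0) (hH : 0 < H)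
    (hh : h ∈ GT k {(H : ℤ)}) (hDh : p ∣ D h)
    {P : Ideal (MvPolynomial (Fin 3) k)} (hP : HP P) (hpP : p ∈ P) (hhP : h ∉ P) : VR p P := by
  have := quot_isDomain hp
  have := quot_charZero hp
  let S := quotLS hC.hl hC.hh hp hpe hDp (hC.hdvd p e hp.ne_zero hpe (by exact_mod_cast he))
  let π := Ideal.Quotient.mk (Ideal.span {p})
  have hπ : Function.Surjective π := Ideal.Quotient.mk_surjective
  have hIP : Ideal.span {p} ≤ P := (Ideal.span_singleton_le_iff_mem _).2 hpP
  have hPp := hP.prime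
  have : (P.map π).IsPrime := Ideal.map_isPrime_of_surjective hπ (by rwa [Ideal.mk_ker])
  intro d b b' hb hb'
  obtain ⟨e, _, _, ⟨v, hv, rfl⟩, ⟨c, hc, rfl⟩, hvP, hor⟩ := S.vr1_aux
    (FractionRing (MvPolynomial (Fin 3) k ⧸ Ideal.span {p})) hH (h := π h) ⟨h, hh, rfl⟩
    ((quotD_mk D hDp h).trans (mk_zero_iff.2 hDh)) (P.map π)
    (by rwa [Ideal.mem_quotient_iff_mem hIP]) (b := π b) (b' := π b') ⟨b, hb, rfl⟩ ⟨b', hb', rfl⟩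
  refine ⟨e, v, c, hv, hc, ?_, ?_⟩
  · have h1 : π v ∉ P.map π := hvP
    rwa [Ideal.mem_quotient_iff_mem hIP] at h1
  · have h1 : π b * π v = π b' * π c ∨ π b' * π v = π b * π c := hor
    refine h1.imp (fun h => mk_zero_iff.1 ?_) (fun h => mk_zero_iff.1 ?_)
    · rw [map_sub, map_mul, map_mul, sub_eq_zero]; exact h
    · rw [map_sub, map_mul, map_mul, sub_eq_zero]; exact h

theorem GT_unique {d e : ℤ} {r : MvPolynomial (Fin 3) k} (hr : r ≠ 0) (h1 : r ∈ GT k {d})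
    (h2 : r ∈ GT k {e}) : d = e := by
  obtain ⟨m, hm⟩ := exists_coeff_ne_zero hr
  have e1 := h1 m hm
  have e2 := h2 m hm
  simp only [Set.mem_singleton_iff] at e1 e2
  omega

theorem not_dvd_low {d e : ℤ} {f r : MvPolynomial (Fin 3) k} (hf : f ∈ GT k {e})
    (hr : r ∈ GT k {d}) (hde : d < e) (hr0 : r ≠ 0) : ¬ f ∣ r := by
  rintro ⟨q, rfl⟩
  obtain ⟨a, b, ha, hb, hab⟩ := hom_factor hr hr0
  have := GT_unique (left_ne_zero_of_mul hr0) hf ha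
  omega

theorem GT_pow {d : ℤ} {r : MvPolynomial (Fin 3) k} (hr : r ∈ GT k {d}) (n : ℕ) :
    r ^ n ∈ GT k {n * d} := by
  induction n with
  | zero => simpa using GT_monomial (m := 0) (T := {(0 : ℤ)}) (1 : k) (by simp [wtz])
  | succ n ih =>
    rw [pow_succ]
    refine GT_mul ?_ ih hr
    intro x hx y hy
    simp only [Set.mem_singleton_iff] at *
    rw [hx, hy]; push_cast; ring

theorem GT_mul' {d e g : ℤ} {u v : MvPolynomial (Fin 3) k} (hu : u ∈ GT k {d}) (hv : v ∈ GT k {e})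
    (h : d + e = g) : u * v ∈ GT k {g} := by
  refine GT_mul ?_ hu hv
  intro x hx y hy
  simp only [Set.mem_singleton_iff] at *
  rw [hx, hy, h]

/-- existence of a positive degree homogeneous element of the kernel modulo `f` -/
theorem Ctx.exists_h (hC : Ctx D N) {f : MvPolynomial (Fin 3) k} (hf : Prime f)
    (hf9 : f ∈ GT k {((9 : ℕ) : ℤ)}) (hDf : D f = 0) :
    ∃ (H : ℕ) (h : MvPolynomial (Fin 3) k), 0 < H ∧ h ∈ GT k {(H : ℤ)} ∧ f ∣ D h ∧ ¬ f ∣ h := by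
  have := quot_isDomain hf
  have := quot_charZero hf
  let S := quotLS hC.hl hC.hh hf hf9 hDf (hC.hdvd f _ hf.ne_zero hf9 (by norm_num))
  let π := Ideal.Quotient.mk (Ideal.span {f})
  by_contra hno
  have hno' : ∀ (H : ℤ) (u), 0 < H → u ∈ S.Gr H → S.D u = 0 → u = 0 := by
    rintro H _ hH ⟨h, hh, rfl⟩ hD
    by_contra h0
    lift H to ℕ using hH.le
    exact hno ⟨H, h, by exact_mod_cast hH, hh, mk_zero_iff.1 ((quotD_mk D hDf h).symm.trans hD),
      fun h' => h0 (mk_zero_iff.2 h')⟩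
  have key : ∀ (d : ℤ) u n, u ∈ S.Gr d → HasDeg S.D u n → d + n * S.δ = 0 := by
    intro d u n hu hn
    have h1 := S.iter_mem hu n
    rcases lt_trichotomy (d + n * S.δ) 0 with h | h | h
    · exact absurd (S.neg_deg h h1) hn.1
    · exact h
    · refine absurd (hno' _ _ h h1 ?_) hn.1
      rw [← Function.iterate_succ_apply' (⇑S.D)]; exact hn.2
  have hY : (X 1 : MvPolynomial (Fin 3) k) ∈ GT k {(2 : ℤ)} := GT_X 1
  have hZ : (X 2 : MvPolynomial (Fin 3) k) ^ 2 ∈ GT k {(2 : ℤ)} := GT_pow (GT_X 2) 2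
  have hlow : ∀ r ∈ GT k {(2 : ℤ)}, r ≠ 0 → π r ≠ 0 := by
    intro r hr hr0 h
    exact not_dvd_low hf9 hr (by norm_num) hr0 (mk_zero_iff.1 h)
  obtain ⟨n, hn⟩ := HasDeg.exists S.lnd (hlow _ hY (X_ne_zero 1))
  obtain ⟨m, hm⟩ := HasDeg.exists S.lnd (hlow _ hZ (pow_ne_zero 2 (X_ne_zero 2)))
  have e1 := key 2 _ n ⟨_, hY, rfl⟩ hn
  have e2 := key 2 _ m ⟨_, hZ, rfl⟩ hm
  have hδ : S.δ ≠ 0 := by intro h; simp [h] at e1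
  have hnm : n = m := by
    have : ((n : ℤ) - m) * S.δ = 0 := by linarith
    have := (mul_eq_zero.1 this).resolve_right hδ
    omega
  subst hnm
  obtain ⟨α, hα⟩ := S.zero_deg (e1 ▸ S.iter_mem (d := 2) (u := π (X 1)) ⟨_, hY, rfl⟩ n)
  obtain ⟨β, hβ⟩ := S.zero_deg (e2 ▸ S.iter_mem (d := 2) (u := π (X 2 ^ 2)) ⟨_, hZ, rfl⟩ n)
  have hβ0 : β ≠ 0 := by
    rintro rfl
    exact hm.1 (by rw [hβ, map_zero])
  have hr : β • (X 1 : MvPolynomial (Fin 3) k) - α • X 2 ^ 2 ∈ GT k {(2 : ℤ)} :=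
    Submodule.sub_mem _ (Submodule.smul_mem _ _ hY) (Submodule.smul_mem _ _ hZ)
  have hr0 : β • (X 1 : MvPolynomial (Fin 3) k) - α • X 2 ^ 2 ≠ 0 := by
    intro h
    have := congrArg (MvPolynomial.eval ![0, 1, 0]) h
    simp [smul_eval] at this
    exact hβ0 this
  obtain ⟨l, hl⟩ := HasDeg.exists S.lnd (hlow _ hr hr0)
  have e3 := key 2 _ l ⟨_, hr, rfl⟩ hl
  have hnl : n = l := by
    have : ((n : ℤ) - l) * S.δ = 0 := by linarith
    have := (mul_eq_zero.1 this).resolve_right hδ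
    omega
  subst hnl
  apply hl.1
  have hb : algebraMap k (MvPolynomial (Fin 3) k ⧸ Ideal.span {f}) β = π (C β) := rfl
  have ha : algebraMap k (MvPolynomial (Fin 3) k ⧸ Ideal.span {f}) α = π (C α) := rfl
  rw [smul_eq_C_mul, smul_eq_C_mul, map_sub, map_mul, map_mul, iter_sub]
  change _ - (⇑S.D)^[n] (π (C α) * π (X 2 ^ 2)) = 0
  rw [iter_ker_mul S.D n (by rw [← hb]; simp), iter_ker_mul S.D n (by rw [← ha]; simp)]
  change π (C β) * (⇑S.D)^[n] (π (X 1)) - _ = 0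
  rw [hα, hβ, ha, hb]
  ring

end Core


section Core2
variable {k : Type} [Field k] [IsAlgClosed k] [CharZero k]
variable {D : Derivation k (MvPolynomial (Fin 3) k) (MvPolynomial (Fin 3) k)} {N : ℤ}

theorem exists_prime_factor {P : Ideal (MvPolynomial (Fin 3) k)} (hP : P.IsPrime)
    {r : MvPolynomial (Fin 3) k} (hr0 : r ≠ 0) (hr : r ∈ P) : ∃ π, Prime π ∧ π ∣ r ∧ π ∈ P := by
  induction r using UniqueFactorizationMonoid.induction_on_prime with
  | h₁ => exact absurd rfl hr0
  | h₂ u hu => exact absurd (Ideal.eq_top_of_isUnit_mem _ hr hu) hP.ne_top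
  | h₃ a p ha hp ih =>
    rcases hP.mem_or_mem hr with h | h
    · exact ⟨p, hp, Dvd.intro a rfl, h⟩
    · obtain ⟨π, h1, h2, h3⟩ := ih ha h
      exact ⟨π, h1, h2.mul_left p, h3⟩

/-- homogeneous prime factors of homogeneous kernel elements -/
theorem Ctx.hom_prime_factor (hC : Ctx D N) {P : Ideal (MvPolynomial (Fin 3) k)} (hP : P.IsPrime)
    {r : MvPolynomial (Fin 3) k} {d : ℤ} (hrd : r ∈ GT k {d}) (hDr : D r = 0) (hr0 : r ≠ 0)
    (hr : r ∈ P) : ∃ (π : MvPolynomial (Fin 3) k) (e : ℕ), Prime π ∧ π ∣ r ∧ π ∈ P ∧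
      π ∈ GT k {(e : ℤ)} ∧ 0 < e ∧ D π = 0 := by
  obtain ⟨π, h1, ⟨q, rfl⟩, h3⟩ := exists_prime_factor hP hr0 hr
  obtain ⟨a, b, ha, hb, hab⟩ := hom_factor hrd hr0
  refine ⟨π, a, h1, Dvd.intro q rfl, h3, ha, ?_, ker_of_mul hC.hl hr0 hDr⟩
  rcases Nat.eq_zero_or_pos a with h | h
  · subst h
    exact absurd (const_mem hP (by simpa using ha) h3) h1.ne_zero
  · exact h

theorem iter_pow_fact {f a : MvPolynomial (Fin 3) k} (hfa : D f = a) (hDa : D a = 0) (m : ℕ) :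
    (⇑D)^[m] (f ^ m) = (m.factorial : MvPolynomial (Fin 3) k) * a ^ m := by
  induction m with
  | zero => simp
  | succ m ih =>
    rw [Function.iterate_succ_apply, Derivation.leibniz_pow, hfa]
    have : (m + 1) • f ^ (m + 1 - 1) • a = (((m + 1 : ℕ) : MvPolynomial (Fin 3) k) * a) * f ^ m := by
      simp only [nsmul_eq_mul, smul_eq_mul, Nat.add_sub_cancel]
      ring
    rw [this, iter_ker_mul D m (by simp [hDa]), ih, Nat.factorial_succ]
    push_cast; ring

theorem Ctx.reduce (hC : Ctx D N) {f a : MvPolynomial (Fin 3) k}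
    {F A : ℕ} (hf : f ∈ GT k {(F : ℤ)}) (hfa : D f = a) (hDa : D a = 0) (hA : (A : ℤ) = F + N)
    (n : ℕ) : ∀ (d : ℤ) (r : MvPolynomial (Fin 3) k), r ∈ GT k {d} → (⇑D)^[n + 1] r = 0 →
      ∃ (M : ℕ) (b : MvPolynomial (Fin 3) k), b ∈ GT k {d + M * A} ∧ D b = 0 ∧ f ∣ a ^ M * r - b := by
  have haA : a ∈ GT k {(A : ℤ)} := by rw [hA, ← hfa]; exact hC.hh.mem hf
  induction n with
  | zero => exact fun d r hr h => ⟨0, r, by simpa using hr, h, by simp⟩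
  | succ n ih =>
    intro d r hr h
    set g := (⇑D)^[n + 1] r with hg
    have hDg : D g = 0 := by rw [hg, ← Function.iterate_succ_apply' (⇑D)]; exact h
    have hgd : g ∈ GT k {d + ((n + 1 : ℕ) : ℤ) * N} := hC.hh.iter_mem hr (n + 1)
    have hm1 : ((n + 1).factorial : MvPolynomial (Fin 3) k) * (a ^ (n + 1) * r) ∈
        GT k {d + ((n + 1 : ℕ) : ℤ) * A} := by
      have h1 : a ^ (n + 1) * r ∈ GT k {d + ((n + 1 : ℕ) : ℤ) * A} :=
        GT_mul' (GT_pow haA (n + 1)) hr (by ring)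
      have h2 := nsmul_mem h1 (n + 1).factorial
      rwa [nsmul_eq_mul] at h2
    have hm2 : g * f ^ (n + 1) ∈ GT k {d + ((n + 1 : ℕ) : ℤ) * A} :=
      GT_mul' hgd (GT_pow hf (n + 1)) (by rw [hA]; ring)
    obtain ⟨M, b, hb, hDb, q, hq⟩ := ih _ _ (Submodule.sub_mem _ hm1 hm2) (by
      rw [iter_sub, iter_ker_mul D (n + 1) (by simp),
        iter_ker_mul D (n + 1) (by simp [Derivation.leibniz_pow, hDa]),
        iter_ker_mul D (n + 1) hDg, iter_pow_fact hfa hDa, ← hg]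
      ring)
    have hfac : ((n + 1).factorial : k) ≠ 0 := by exact_mod_cast Nat.factorial_ne_zero _
    have hCC : C (((n + 1).factorial : k)⁻¹) * ((n + 1).factorial : MvPolynomial (Fin 3) k) = 1 := by
      rw [← map_natCast (C : k →+* MvPolynomial (Fin 3) k), ← C_mul, inv_mul_cancel₀ hfac, C_1]
    refine ⟨M + (n + 1), (((n + 1).factorial : k)⁻¹) • b, ?_, by simp [hDb], ?_⟩
    · refine Submodule.smul_mem _ _ ?_
      convert hb using 3
      push_cast; ring
    · refine ⟨C (((n + 1).factorial : k)⁻¹) * (q + a ^ M * g * f ^ n), ?_⟩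
      rw [smul_eq_C_mul]
      linear_combination (C (((n + 1).factorial : k)⁻¹)) * hq - (a ^ (M + (n + 1)) * r) * hCC

theorem Ctx.vr2 (hC : Ctx D N) {f a : MvPolynomial (Fin 3) k}
    {F A : ℕ} (hf : f ∈ GT k {(F : ℤ)}) (hfa : D f = a) (hDa : D a = 0) (hA : (A : ℤ) = F + N)
    (hA0 : 0 < A) {P : Ideal (MvPolynomial (Fin 3) k)} (hP : HP P)
    (haP : a ∉ P) : VR f P := by
  have haA : a ∈ GT k {(A : ℤ)} := by rw [hA, ← hfa]; exact hC.hh.mem hf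
  have hPp := hP.prime
  have haM : ∀ M : ℕ, a ^ M ∉ P := fun M h => haP (hPp.mem_of_pow_mem _ h)
  intro d b b' hb hb'
  have red : ∀ r ∈ GT k {(d : ℤ)}, ∃ (M : ℕ) (β : MvPolynomial (Fin 3) k),
      β ∈ GT k {(d : ℤ) + M * A} ∧ D β = 0 ∧ f ∣ a ^ M * r - β := by
    intro r hr
    obtain ⟨n, hn⟩ := hC.hl r
    exact hC.reduce hf hfa hDa hA n d r hr (iter_zero_of_le D hn (by omega))
  obtain ⟨M1, β, hβ, hDβ, hfβ⟩ : ∃ (M : ℕ) (β : MvPolynomial (Fin 3) k),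
      β ∈ GT k {(d : ℤ) + M * A} ∧ D β = 0 ∧ f ∣ a ^ M * b - β := red b hb
  obtain ⟨M2, β', hβ', hDβ', hfβ'⟩ := red b' hb'
  rcases eq_or_ne β 0 with h0 | hβ0
  · refine ⟨M1 * A, a ^ M1, 0, by simpa using GT_pow haA M1, Submodule.zero_mem _, haM _, Or.inl ?_⟩
    rw [h0] at hfβ
    convert hfβ using 1; ring
  rcases eq_or_ne β' 0 with h0 | hβ'0
  · refine ⟨M2 * A, a ^ M2, 0, by simpa using GT_pow haA M2, Submodule.zero_mem _, haM _, Or.inr ?_⟩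
    rw [h0] at hfβ'
    convert hfβ' using 1; ring
  -- common power
  have ha0 : a ≠ 0 := by rintro rfl; exact haP P.zero_mem
  obtain ⟨g, hg, hDg, hg0, hfg⟩ : ∃ g, g ∈ GT k {(d : ℤ) + (M1 + M2 : ℕ) * A} ∧ D g = 0 ∧ g ≠ 0 ∧
      f ∣ a ^ (M1 + M2) * b - g := by
    refine ⟨a ^ M2 * β, GT_mul' (GT_pow haA M2) hβ (by push_cast; ring),
      by simp [Derivation.leibniz_pow, hDa, hDβ], mul_ne_zero (pow_ne_zero _ ha0) hβ0, ?_⟩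
    have := hfβ.mul_left (a ^ M2)
    convert this using 1; ring
  obtain ⟨g', hg', hDg', hg'0, hfg'⟩ : ∃ g, g ∈ GT k {(d : ℤ) + (M1 + M2 : ℕ) * A} ∧ D g = 0 ∧
      g ≠ 0 ∧ f ∣ a ^ (M1 + M2) * b' - g := by
    refine ⟨a ^ M1 * β', GT_mul' (GT_pow haA M1) hβ' (by push_cast; ring),
      by simp [Derivation.leibniz_pow, hDa, hDβ'], mul_ne_zero (pow_ne_zero _ ha0) hβ'0, ?_⟩
    have := hfβ'.mul_left (a ^ M1)
    convert this using 1; ring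
  generalize M1 + M2 = M at *
  obtain ⟨γ, γ', c, hrel, rfl, rfl⟩ := UniqueFactorizationMonoid.exists_reduced_factors' g g' hg'0
  obtain ⟨s, t, hs, ht, hst⟩ := hom_factor hg hg0
  obtain ⟨s', t', hs', ht', hst'⟩ := hom_factor hg' hg'0
  have hss := GT_unique (left_ne_zero_of_mul hg0) hs hs'
  obtain rfl : t = t' := by omega
  have hDγ : D γ = 0 := ker_of_mul hC.hl (u := γ) (v := c) (by rwa [mul_comm]) (by rwa [mul_comm])
  have hDγ' : D γ' = 0 :=
    ker_of_mul hC.hl (u := γ') (v := c) (by rwa [mul_comm]) (by rwa [mul_comm])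
  have hγ0 := right_ne_zero_of_mul hg0
  have hγ'0 := right_ne_zero_of_mul hg'0
  have claim : γ ∉ P ∨ γ' ∉ P := by
    by_contra hc
    push Not at hc
    obtain ⟨p, e, hp, hpd, hpP, hpe, he, hDp⟩ := hC.hom_prime_factor hPp ht hDγ hγ0 hc.1
    obtain ⟨p', e', hp', hpd', hpP', hpe', he', hDp'⟩ :=
      hC.hom_prime_factor hPp ht' hDγ' hγ'0 hc.2
    obtain ⟨κ, q, hq⟩ := hC.kpow hp hpe he hDp haA hpe' (by simp [hDa]) (by simp [hDp'])
      (fun h => haP (P.mem_of_dvd h hpP)) (fun h => hp.not_isUnit (hrel hpd (h.trans hpd')))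
    refine haM e' ?_
    rw [sub_eq_iff_eq_add.1 hq]
    exact P.add_mem (P.mul_mem_right _ hpP) (P.mul_mem_left _ (P.pow_mem_of_mem hpP' _ hA0))
  obtain ⟨q, hq⟩ := hfg
  obtain ⟨q', hq'⟩ := hfg'
  have hdeg : ∀ r ∈ GT k {(t : ℤ)}, a ^ M * r ∈ GT k {((M * A + t : ℕ) : ℤ)} := fun r hr =>
    GT_mul' (GT_pow haA M) hr (by push_cast; ring)
  have hnot : ∀ r, r ∉ P → a ^ M * r ∉ P := fun r hr h =>
    (hPp.mem_or_mem h).elim (haM M) hr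
  rcases claim with h | h
  · refine ⟨M * A + t, a ^ M * γ, a ^ M * γ', hdeg _ ht, hdeg _ ht', hnot _ h, Or.inr ?_⟩
    refine ⟨q' * γ - q * γ', ?_⟩
    linear_combination γ * hq' - γ' * hq
  · refine ⟨M * A + t, a ^ M * γ', a ^ M * γ, hdeg _ ht', hdeg _ ht, hnot _ h, Or.inl ?_⟩
    refine ⟨q * γ' - q' * γ, ?_⟩
    linear_combination γ' * hq - γ * hq'

theorem core_eq {D₀ : Derivation k (MvPolynomial (Fin 3) k) (MvPolynomial (Fin 3) k)}
    (hD₀ : IsLND D₀) (hD0 : D₀ ≠ 0) {f : MvPolynomial (Fin 3) k} (hf : Prime f)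
    (hf9 : f ∈ GT k {((9 : ℕ) : ℤ)}) (hDf₀ : D₀ (D₀ f) = 0)
    {P Q : Ideal (MvPolynomial (Fin 3) k)} (hP : HP P) (hQ : HP Q) (hfP : f ∈ P) (hfQ : f ∈ Q)
    (hVP : ¬ VR f P) (hVQ : ¬ VR f Q) : P = Q := by
  obtain ⟨N, D, hl, h0, hh, hDf, hdvd⟩ := minimalD hD₀ hD0 hf9 hDf₀
  have hN : -3 ≤ N := by
    obtain ⟨j, hj⟩ := exists_X_ne h0
    obtain ⟨m, hm⟩ := exists_coeff_ne_zero hj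
    have h1 := hh j m hm
    have h2 := wtz_nonneg m
    have h3 : w3 j ≤ 3 := by fin_cases j <;> simp [w3]
    simp only [Set.mem_singleton_iff] at h1
    omega
  have hC : Ctx D N := ⟨hl, hh, hN, hdvd⟩
  by_cases ha : D f = 0
  · obtain ⟨H, h, hH, hh, hDh, hfh⟩ := hC.exists_h hf hf9 ha
    have h1 : h ∈ P := by
      by_contra h'
      exact hVP (hC.vr1 hf hf9 (by norm_num) ha hH hh hDh hP hfP h')
    have h2 : h ∈ Q := by
      by_contra h'
      exact hVQ (hC.vr1 hf hf9 (by norm_num) ha hH hh hDh hQ hfQ h')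
    exact le_antisymm
      (hC.uniq hf hf9 (by norm_num) ha hH hh hDh hfh hP hQ.prime hfP hfQ h1 h2)
      (hC.uniq hf hf9 (by norm_num) ha hH hh hDh hfh hQ hP.prime hfQ hfP h2 h1)
  · obtain ⟨A, hA⟩ : ∃ A : ℕ, (A : ℤ) = ((9 : ℕ) : ℤ) + N :=
      ⟨(9 + N).toNat, by push_cast; omega⟩
    have hA0 : 0 < A := by push_cast at hA; omega
    have haP : D f ∈ P := by
      by_contra h'
      exact hVP (hC.vr2 hf9 rfl hDf hA hA0 hP h')
    have haQ : D f ∈ Q := by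
      by_contra h'
      exact hVQ (hC.vr2 hf9 rfl hDf hA hA0 hQ h')
    have haA := hC.hh.mem hf9
    obtain ⟨p, e, hp, hpd, hpP, hpe, he, hDp⟩ := hC.hom_prime_factor hP.prime haA hDf ha haP
    obtain ⟨q, e', hq, hqd, hqQ, hqe, he', hDq⟩ := hC.hom_prime_factor hQ.prime haA hDf ha haQ
    have hnd : ∀ p, Prime p → D p = 0 → ¬ p ∣ f := by
      intro p hp hDp h
      obtain ⟨u, rfl⟩ := (hp.associated_of_dvd hf h).symm.dvd
      exact ha (ker_of_mul hC.hl hp.ne_zero hDp)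
    have fin : ∀ (p : MvPolynomial (Fin 3) k) (e : ℕ), Prime p → p ∣ D f → p ∈ P → p ∈ Q →
        p ∈ GT k {(e : ℤ)} → 0 < e → D p = 0 → P = Q := by
      intro p e hp hpd hpP hpQ hpe he hDp
      exact le_antisymm
        (hC.uniq hp hpe he hDp (by norm_num) hf9 hpd (hnd p hp hDp) hP hQ.prime hpP hpQ hfP hfQ)
        (hC.uniq hp hpe he hDp (by norm_num) hf9 hpd (hnd p hp hDp) hQ hP.prime hpQ hpP hfQ hfP)
    by_cases hpq : p ∣ q
    · have : q ∣ p := (hp.associated_of_dvd hq hpq).symm.dvd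
      exact fin p e hp hpd hpP (Q.mem_of_dvd this hqQ) hpe he hDp
    · obtain ⟨c, r, hr⟩ := hC.kpow hp hpe he hDp hqe hf9 (by simp [hDq]) hpd hpq (hnd p hp hDp)
      refine fin q e' hq hqd ?_ hqQ hqe he' hDq
      refine hP.prime.mem_of_pow_mem 9 ?_
      rw [sub_eq_iff_eq_add.1 hr]
      exact P.add_mem (P.mul_mem_right _ hpP) (P.mul_mem_left _ (P.pow_mem_of_mem hfP _ he'))

end Core2

theorem reg_of_val {S : Type*} [CommRing S] [IsDomain S] [IsLocalRing S] [IsNoetherianRing S]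
    [ValuationRing S] : IsRegLocalRing S := by
  have hpir : IsPrincipalIdealRing S := ((IsBezout.TFAE (R := S)).out 0 1).mp ‹IsNoetherianRing S›
  refine ⟨inferInstance, inferInstance, ?_⟩
  rw [IsLocalRing.jacobson_eq_maximalIdeal ⊥ bot_ne_top]
  by_cases hF : IsField S
  · refine ⟨∅, ?_, ?_⟩
    · rw [IsLocalRing.isField_iff_maximalIdeal_eq.1 hF]; simp
    · rw [ringKrullDim_eq_zero_of_isField hF]; simp; rfl
  · obtain ⟨a, ha⟩ := hpir.principal (IsLocalRing.maximalIdeal S)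
    refine ⟨{a}, ?_, ?_⟩
    · rw [ha]; simp
    · rw [IsPrincipalIdealRing.ringKrullDim_eq_one S hF]; simp; rfl

section Pr
variable {k : Type} [Field k] [IsAlgClosed k] [CharZero k] {f : MvPolynomial (Fin 3) k}
  (ℬ : ℕ → Submodule k (MvPolynomial (Fin 3) k ⧸ Ideal.span {f})) [GradedAlgebra ℬ]
  (hℬ : ∀ (i : ℕ) (r : MvPolynomial (Fin 3) k), r.IsWeightedHomogeneous w3 i →
      Ideal.Quotient.mk (Ideal.span {f}) r ∈ ℬ i)
include hℬ

theorem dec_mk (r : MvPolynomial (Fin 3) k) (i : ℕ) :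
    (DirectSum.decompose ℬ (Ideal.Quotient.mk (Ideal.span {f}) r) i :
      MvPolynomial (Fin 3) k ⧸ Ideal.span {f}) =
      Ideal.Quotient.mk (Ideal.span {f}) (hcomp (i:ℤ) r) := by
  have key : ∀ (d : ℤ) (p : MvPolynomial (Fin 3) k), p ∈ GT k {d} →
     (DirectSum.decompose ℬ (Ideal.Quotient.mk (Ideal.span {f}) p) i :
      MvPolynomial (Fin 3) k ⧸ Ideal.span {f}) =
      Ideal.Quotient.mk (Ideal.span {f}) (hcomp (i:ℤ) p) := by
    intro d p hp
    rcases lt_or_ge d 0 with hd | hd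
    · rw [GT_neg hd hp]
      have : hcomp (i:ℤ) (0 : MvPolynomial (Fin 3) k) = 0 := by
        have := cmp_sum (k := k) (i:ℤ) (∅ : Finset ℕ) (fun _ => 0)
        simpa using this
      rw [this]; simp
    · obtain ⟨n, rfl⟩ := Int.eq_ofNat_of_zero_le hd
      have hm := hℬ n p (GT_iff_wh.1 hp)
      by_cases hn : n = i
      · subst hn
        rw [DirectSum.decompose_of_mem_same ℬ hm, cmp_eq_self hp]
      · rw [DirectSum.decompose_of_mem_ne ℬ hm hn, cmp_ne (by exact_mod_cast (Ne.symm hn)) hp, map_zero]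
  obtain ⟨s, hs⟩ := sum_cmp r
  conv_lhs => rw [hs]
  conv_rhs => rw [hs]
  rw [cmp_sum, map_sum (Ideal.Quotient.mk (Ideal.span {f})), map_sum (Ideal.Quotient.mk (Ideal.span {f})), DirectSum.decompose_sum, DFinsupp.finset_sum_apply,
    AddSubmonoidClass.coe_finset_sum]
  exact Finset.sum_congr rfl fun d _ => key d _ (cmp_mem d r)

theorem lift_mem {b : MvPolynomial (Fin 3) k ⧸ Ideal.span {f}} {i : ℕ} (hb : b ∈ ℬ i) :
    ∃ r, r ∈ GT k {(i:ℤ)} ∧ Ideal.Quotient.mk (Ideal.span {f}) r = b := by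
  obtain ⟨r, rfl⟩ := Ideal.Quotient.mk_surjective b
  refine ⟨hcomp i r, cmp_mem _ _, ?_⟩
  rw [← dec_mk ℬ hℬ, DirectSum.decompose_of_mem_same ℬ hb]

theorem HP_of_pt (x : ProjectiveSpectrum ℬ) :
    HP (x.asHomogeneousIdeal.toIdeal.comap (Ideal.Quotient.mk (Ideal.span {f}))) where
  prime := inferInstance
  hom := by
    intro r hr d
    rcases lt_or_ge d 0 with hd | hd
    · rw [GT_neg hd (cmp_mem d r)]; exact zero_mem _
    · obtain ⟨n, rfl⟩ := Int.eq_ofNat_of_zero_le hd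
      rw [Ideal.mem_comap, ← dec_mk ℬ hℬ]
      exact x.asHomogeneousIdeal.isHomogeneous n hr
  rel := by
    by_contra hcon
    push Not at hcon
    apply x.not_irrelevant_le
    intro b hb
    obtain ⟨r, rfl⟩ := Ideal.Quotient.mk_surjective b
    rw [HomogeneousIdeal.mem_irrelevant_iff, GradedRing.proj_apply] at hb
    show Ideal.Quotient.mk (Ideal.span {f}) r ∈ x.asHomogeneousIdeal.toIdeal
    classical
    rw [← DirectSum.sum_support_decompose ℬ (Ideal.Quotient.mk (Ideal.span {f}) r)]
    refine Ideal.sum_mem _ fun i _ => ?_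
    rcases Nat.eq_zero_or_pos i with rfl | hi
    · rw [hb]; exact zero_mem _
    · rw [dec_mk ℬ hℬ]
      exact hcon i _ hi (cmp_mem _ _)

theorem zero_surj : Function.Surjective (algebraMap k (ℬ 0)) := by
  rintro ⟨b, hb⟩
  obtain ⟨r, hr, rfl⟩ := lift_mem ℬ hℬ hb
  obtain ⟨c, rfl⟩ := GT_zero_const hr
  exact ⟨c, Subtype.ext rfl⟩

theorem noeth_stalk (x : AlgebraicGeometry.Proj ℬ) :
    IsNoetherianRing ((AlgebraicGeometry.Proj ℬ).presheaf.stalk x) := by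
  have h0 : IsNoetherianRing (ℬ 0) := isNoetherianRing_of_surjective k _ _ (zero_surj ℬ hℬ)
  have h1 : Algebra.FiniteType k (MvPolynomial (Fin 3) k ⧸ Ideal.span {f}) := inferInstance
  have : IsScalarTower k (ℬ 0) (MvPolynomial (Fin 3) k ⧸ Ideal.span {f}) :=
    ⟨fun a b c => smul_mul_assoc a (b : MvPolynomial (Fin 3) k ⧸ Ideal.span {f}) c⟩
  have h2 : Algebra.FiniteType (ℬ 0) (MvPolynomial (Fin 3) k ⧸ Ideal.span {f}) :=
    Algebra.FiniteType.of_restrictScalars_finiteType k _ _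
  have h3 := AlgebraicGeometry.LocallyOfFiniteType.isLocallyNoetherian
    (AlgebraicGeometry.Proj.toSpecZero ℬ)
  infer_instance

theorem reg_of_VR (hf : Prime f) (x : AlgebraicGeometry.Proj ℬ)
    (hV : VR f ((ProjectiveSpectrum.asHomogeneousIdeal x).toIdeal.comap (Ideal.Quotient.mk (Ideal.span {f})))) :
    IsRegLocalRing ((AlgebraicGeometry.Proj ℬ).presheaf.stalk x) := by
  have hN := noeth_stalk ℬ hℬ x
  have hdom := quot_isDomain hf
  let Q := (ProjectiveSpectrum.asHomogeneousIdeal x).toIdeal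
  have hQ : Q.IsPrime := ProjectiveSpectrum.isPrime x
  let S := HomogeneousLocalization.AtPrime ℬ Q
  let e : ((AlgebraicGeometry.Proj ℬ).presheaf.stalk x) ≃+* S :=
    (AlgebraicGeometry.Proj.stalkIso ℬ x).commRingCatIsoToRingEquiv
  have hSdom : IsDomain S := by
    have : IsDomain (Localization.AtPrime Q) := inferInstance
    exact Function.Injective.isDomain (algebraMap S (Localization.AtPrime Q))
      (HomogeneousLocalization.val_injective _)
  have hdomS : IsDomain ((AlgebraicGeometry.Proj ℬ).presheaf.stalk x) := e.isDomain_iff.2 hSdom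
  have key : ∀ a b : S, ∃ c, a * c = b ∨ b * c = a := by
    intro a b
    obtain ⟨⟨i, ⟨a1, ha1⟩, ⟨a2, ha2⟩, ha3⟩, rfl⟩ := HomogeneousLocalization.mk_surjective a
    obtain ⟨⟨j, ⟨b1, hb1⟩, ⟨b2, hb2⟩, hb3⟩, rfl⟩ := HomogeneousLocalization.mk_surjective b
    obtain ⟨p, hp, hp1⟩ := lift_mem ℬ hℬ (SetLike.GradedMul.mul_mem ha1 hb2)
    obtain ⟨q, hq, hq1⟩ := lift_mem ℬ hℬ (SetLike.GradedMul.mul_mem ha2 hb1)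
    obtain ⟨m, v, c, hv, hc, hvP, h⟩ := hV _ _ _ hp hq
    have hv' := hℬ m v (GT_iff_wh.1 hv)
    have hc' := hℬ m c (GT_iff_wh.1 hc)
    refine ⟨HomogeneousLocalization.mk ⟨m, ⟨_, hc'⟩, ⟨_, hv'⟩, hvP⟩, ?_⟩
    rcases h with h | h
    · right
      rw [← mk_zero_iff, map_sub, map_mul, map_mul, hp1, hq1, sub_eq_zero] at h
      apply HomogeneousLocalization.val_injective
      rw [HomogeneousLocalization.val_mul, HomogeneousLocalization.val_mk,
        HomogeneousLocalization.val_mk, HomogeneousLocalization.val_mk, Localization.mk_mul,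
        Localization.mk_eq_mk_iff, Localization.r_iff_exists]
      refine ⟨1, ?_⟩
      simp only [Submonoid.coe_mul, OneMemClass.coe_one, one_mul]
      linear_combination -h
    · left
      rw [← mk_zero_iff, map_sub, map_mul, map_mul, hp1, hq1, sub_eq_zero] at h
      apply HomogeneousLocalization.val_injective
      rw [HomogeneousLocalization.val_mul, HomogeneousLocalization.val_mk,
        HomogeneousLocalization.val_mk, HomogeneousLocalization.val_mk, Localization.mk_mul,
        Localization.mk_eq_mk_iff, Localization.r_iff_exists]
      refine ⟨1, ?_⟩
      simp only [Submonoid.coe_mul, OneMemClass.coe_one, one_mul]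
      linear_combination -h
  have hval : ValuationRing ((AlgebraicGeometry.Proj ℬ).presheaf.stalk x) := by
    refine { cond' := fun a b => ?_ }
    obtain ⟨c, hc⟩ := key (e a) (e b)
    refine ⟨e.symm c, ?_⟩
    rcases hc with hc | hc
    · left; apply e.injective; simpa using hc
    · right; apply e.injective; simpa using hc
  exact reg_of_val
end Pr

/-- Theorem 1.1 (main1): if `f ∈ R₉` satisfies (C1)-(C3), then `|f|_R ≥ 2`: there is no
nonzero locally nilpotent derivation `D` of `R = k[x,y,z]` with `D²f = 0`. -/
theorem statement_0 (k : Type) [Field k] [IsAlgClosed k] [CharZero k]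
    (f : MvPolynomial (Fin 3) k)
    (hf9 : f.IsWeightedHomogeneous w3 9)
    (hC1 : Irreducible f)
    (hC2 : CondC2 k f)
    (hC3 : CondC3 k f) :
    ∀ D : Derivation k (MvPolynomial (Fin 3) k) (MvPolynomial (Fin 3) k),
      IsLND D → D ≠ 0 → D (D f) ≠ 0 := by

  intro D hD hD0 hDDf
  obtain ⟨ℬ, inst, hℬ, x, y, hxy, hx, hy⟩ := hC2
  have hf : Prime f := hC1.prime
  apply hxy
  have hmem : ∀ z : ProjectiveSpectrum ℬ, f ∈ z.asHomogeneousIdeal.toIdeal.comap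
      (Ideal.Quotient.mk (Ideal.span {f})) := by
    intro z
    rw [Ideal.mem_comap, mk_zero_iff.2 dvd_rfl]
    exact zero_mem _
  have h := core_eq hD hD0 hf (GT_iff_wh.2 hf9) hDDf (HP_of_pt ℬ hℬ x) (HP_of_pt ℬ hℬ y)
    (hmem x) (hmem y) (fun h => hx (reg_of_VR ℬ hℬ hf x h)) (fun h => hy (reg_of_VR ℬ hℬ hf y h))
  apply ProjectiveSpectrum.ext
  apply HomogeneousIdeal.toIdeal_injective
  exact Ideal.comap_injective_of_surjective _ Ideal.Quotient.mk_surjective h
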